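/- arXiv:1409.2811 — 2 statements merged into one kernel-verified Lean document; each statement's English description precedes it below -/
import Mathlib

section
/- Let W : ℝ^d → ℝ satisfy assumptions (A0)–(A2). Let (W_n)_{n≥1} be even functions in C¹(ℝ^d), each λ-convex with |∇W_n(x)| ≤ w_∞ for all x, and such that sup_{x ∈ ℝ^d \ B(0,1/n)} |∇W_n(x) − ∇W(x)| ≤ 1/n for all n ≥ 1. Let (ρ_n) be Borel probability measures on ℝ^d converging narrowly to a Borel probability measure ρ (i.e. ∫ f dρ_n → ∫ f dρ for every bounded continuous f). Then for every continuous compactly supported φ : ℝ^d → ℝ, lim_{n→∞} ∬_{ℝ^d×ℝ^d} φ(x) ∇W_n(x − y) ρ_n(dx) ρ_n(dy) = ∬_{(ℝ^d×ℝ^d) \ D} φ(x) ∇W(x − y) ρ(dx) ρ(dy), where D = {(x,x) : x ∈ ℝ^d} is the diagonal. -/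
open MeasureTheory Filter Metric
open scoped RealInnerProductSpace Topology BigOperators NNReal ENNReal Classical

noncomputable section

/-- The extended gradient `∇̂W`: `∇W(x)` for `x ≠ 0` and `0` at the origin. -/
def hatGrad (d : ℕ) (W : EuclideanSpace ℝ (Fin d) → ℝ) (x : EuclideanSpace ℝ (Fin d)) :
    EuclideanSpace ℝ (Fin d) :=
  if x = 0 then 0 else gradient W x

/-- Assumptions (A0)-(A2): `W` is Lipschitz with constant `winf ≥ 0`, even, `W 0 = 0`,
`lam`-convex for some `lam ≤ 0`, continuously differentiable away from the origin,
with gradient bounded by `winf` away from the origin. -/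
structure PointyPotential (d : ℕ) (W : EuclideanSpace ℝ (Fin d) → ℝ) (winf lam : ℝ) : Prop where
  winf_nonneg : 0 ≤ winf
  lipschitz : LipschitzWith (Real.toNNReal winf) W
  even : ∀ x, W (-x) = W x
  zero_val : W 0 = 0
  lam_nonpos : lam ≤ 0
  lamConvex : ConvexOn ℝ Set.univ fun x => W x - lam / 2 * ‖x‖ ^ 2
  diffAway : ∀ x : EuclideanSpace ℝ (Fin d), x ≠ 0 → DifferentiableAt ℝ W x
  gradContinuous : ContinuousOn (gradient W) {x : EuclideanSpace ℝ (Fin d) | x ≠ 0}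
  gradBound : ∀ x : EuclideanSpace ℝ (Fin d), x ≠ 0 → ‖gradient W x‖ ≤ winf

/-- A smooth even `lam`-convex approximating potential with gradient bounded by `winf`. -/
structure SmoothApproxPotential (d : ℕ) (Wn : EuclideanSpace ℝ (Fin d) → ℝ)
    (winf lam : ℝ) : Prop where
  smooth : ContDiff ℝ 1 Wn
  even : ∀ x, Wn (-x) = Wn x
  lamConvex : ConvexOn ℝ Set.univ fun x => Wn x - lam / 2 * ‖x‖ ^ 2
  gradBound : ∀ x, ‖gradient Wn x‖ ≤ winf

section Gradient

variable {E : Type*} [NormedAddCommGroup E] [InnerProductSpace ℝ E] [CompleteSpace E]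

/-- The gradient of an even function is odd. -/
theorem gradient_neg_of_even {f : E → ℝ} (hf : ∀ x, f (-x) = f x) (x : E) :
    gradient f (-x) = -gradient f x := by
  have h := (ContinuousLinearEquiv.neg ℝ (M := E)).comp_right_fderiv (f := f) (x := x)
  have hcomp : f ∘ ContinuousLinearEquiv.neg ℝ (M := E) = f := funext hf
  have hneg : fderiv ℝ f (-x) = -fderiv ℝ f x := by
    rw [hcomp] at h
    ext v
    simp [h]
  rw [gradient, gradient, hneg, map_neg]

theorem gradient_zero_of_even {f : E → ℝ} (hf : ∀ x, f (-x) = f x) : gradient f 0 = 0 := by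
  have h := gradient_neg_of_even hf 0
  rw [neg_zero] at h
  have h2 : (2 : ℝ) • gradient f 0 = 0 := by
    rw [two_smul]
    exact eq_neg_iff_add_eq_zero.mp h
  exact (smul_eq_zero.mp h2).resolve_left two_ne_zero

theorem measurable_gradient [MeasurableSpace E] [BorelSpace E] (f : E → ℝ) :
    Measurable (gradient f) :=
  (InnerProductSpace.toDual ℝ E).symm.continuous.measurable.comp (measurable_fderiv ℝ f)

end Gradient

section Symmetrization

variable {E : Type*} [NormedAddCommGroup E] [NormedSpace ℝ E] [MeasurableSpace E] [BorelSpace E]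
  [SecondCountableTopology E]

theorem integrable_smul_comp_sub {g : E → E} {φ : E → ℝ} {C M : ℝ}
    (hg : Measurable g) (hgC : ∀ x, ‖g x‖ ≤ C) (hφ : Continuous φ) (hφM : ∀ x, |φ x| ≤ M)
    (μ : Measure E) [IsProbabilityMeasure μ] :
    Integrable (fun p : E × E => φ p.1 • g (p.1 - p.2)) (μ.prod μ) := by
  refine Integrable.of_bound (C := M * C) ?_ (Eventually.of_forall fun p => ?_)
  · exact ((hφ.measurable.comp measurable_fst).smul
      (hg.comp (measurable_fst.sub measurable_snd))).aestronglyMeasurable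
  · rw [norm_smul, Real.norm_eq_abs]
    exact mul_le_mul (hφM _) (hgC _) (norm_nonneg _) ((abs_nonneg _).trans (hφM p.1))

/-- Symmetrization of an interaction integral with an odd kernel. -/
theorem integral_sub_smul_comp_sub {g : E → E} {φ : E → ℝ} {C M : ℝ}
    (hg : Measurable g) (hgC : ∀ x, ‖g x‖ ≤ C) (hodd : ∀ x, g (-x) = -g x)
    (hφ : Continuous φ) (hφM : ∀ x, |φ x| ≤ M) (μ : Measure E) [IsProbabilityMeasure μ] :
    ∫ p : E × E, (φ p.1 - φ p.2) • g (p.1 - p.2) ∂(μ.prod μ) =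
      (2 : ℝ) • ∫ p : E × E, φ p.1 • g (p.1 - p.2) ∂(μ.prod μ) := by
  have hint := integrable_smul_comp_sub hg hgC hφ hφM μ
  have hswap := integral_prod_swap (μ := μ) (ν := μ) fun p : E × E => φ p.1 • g (p.1 - p.2)
  have hodd' (p : E × E) : (φ p.1 - φ p.2) • g (p.1 - p.2) =
      φ p.1 • g (p.1 - p.2) + φ p.swap.1 • g (p.swap.1 - p.swap.2) := by
    have h := hodd (p.1 - p.2)
    rw [neg_sub] at h
    rw [Prod.fst_swap, Prod.snd_swap, h, smul_neg, sub_smul, sub_eq_add_neg]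
  simp_rw [hodd']
  have hint' : Integrable (fun p : E × E => φ p.swap.1 • g (p.swap.1 - p.swap.2)) (μ.prod μ) :=
    hint.swap
  rw [integral_add hint hint', hswap, two_smul]

end Symmetrization

/-- If `g` is bounded and continuous away from the origin, then multiplying `g (x - y)` by
`φ x - φ y` removes the discontinuity on the diagonal. -/
theorem continuous_sub_smul_comp_sub {E : Type*} [NormedAddCommGroup E] [NormedSpace ℝ E]
    {g : E → E} {φ : E → ℝ} {C : ℝ}
    (hgc : ContinuousOn g {x | x ≠ 0}) (hgC : ∀ x, ‖g x‖ ≤ C) (hφ : Continuous φ) :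
    Continuous fun p : E × E => (φ p.1 - φ p.2) • g (p.1 - p.2) := by
  have hdiff : Continuous fun p : E × E => φ p.1 - φ p.2 := by fun_prop
  refine continuous_iff_continuousAt.mpr fun p => ?_
  by_cases hp : p.1 - p.2 = 0
  · have hp' : φ p.1 - φ p.2 = 0 := by rw [sub_eq_zero.mp hp, sub_self]
    have h0 : Tendsto (fun q : E × E => |φ q.1 - φ q.2| * C) (𝓝 p) (𝓝 0) := by
      have h := (hdiff.abs.mul_const C).tendsto p
      simpa only [hp', abs_zero, zero_mul] using h
    rw [ContinuousAt, hp', zero_smul]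
    refine squeeze_zero_norm (fun q => ?_) h0
    rw [norm_smul, Real.norm_eq_abs]
    exact mul_le_mul_of_nonneg_left (hgC _) (abs_nonneg _)
  · have hg : ContinuousAt g (p.1 - p.2) := hgc.continuousAt (isOpen_ne.mem_nhds hp)
    exact hdiff.continuousAt.smul
      (ContinuousAt.comp (f := fun q : E × E => q.1 - q.2) hg (by fun_prop))

/-- If `g n` is uniformly bounded and converges to `G` uniformly away from the origin, the
symmetrized integrands converge uniformly. -/
theorem tendstoUniformly_sub_smul_comp_sub {E : Type*} [NormedAddCommGroup E] [NormedSpace ℝ E]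
    {g : ℕ → E → E} {G : E → E} {φ : E → ℝ} {C M : ℝ}
    (hg : ∀ n, 1 ≤ n → ∀ x, ‖g n x‖ ≤ C) (hG : ∀ x, ‖G x‖ ≤ C)
    (happrox : ∀ n : ℕ, 1 ≤ n → ∀ x, (1 : ℝ) / n ≤ ‖x‖ → ‖g n x - G x‖ ≤ 1 / n)
    (hφ : UniformContinuous φ) (hφM : ∀ x, |φ x| ≤ M) :
    TendstoUniformly (fun n (p : E × E) => (φ p.1 - φ p.2) • g n (p.1 - p.2))
      (fun p => (φ p.1 - φ p.2) • G (p.1 - p.2)) atTop := by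
  have hC : 0 ≤ C := (norm_nonneg _).trans (hG 0)
  have hM : 0 ≤ M := (abs_nonneg _).trans (hφM 0)
  rw [Metric.tendstoUniformly_iff]
  intro ε hε
  obtain ⟨δ, hδ, hφδ⟩ := Metric.uniformContinuous_iff.mp hφ (ε / (2 * C + 1)) (by positivity)
  have hlim : Tendsto (fun n : ℕ => (1 : ℝ) / n) atTop (𝓝 0) := tendsto_one_div_atTop_nhds_zero_nat
  filter_upwards [eventually_ge_atTop 1, hlim.eventually_lt_const hδ,
    hlim.eventually_lt_const (show 0 < ε / (2 * M + 1) by positivity)] with n hn hnδ hnε p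
  rw [dist_comm, dist_eq_norm, ← smul_sub, norm_smul, Real.norm_eq_abs]
  rcases le_or_gt ((1 : ℝ) / n) ‖p.1 - p.2‖ with h | h
  · calc |φ p.1 - φ p.2| * ‖g n (p.1 - p.2) - G (p.1 - p.2)‖
        ≤ (2 * M) * (1 / n) := by
          refine mul_le_mul ?_ (happrox n hn _ h) (norm_nonneg _) (by positivity)
          linarith [abs_sub (φ p.1) (φ p.2), hφM p.1, hφM p.2]
      _ ≤ (2 * M) * (ε / (2 * M + 1)) := by gcongr
      _ < ε := by
          rw [← mul_div_assoc, div_lt_iff₀ (by positivity)]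
          nlinarith
  · have hd : |φ p.1 - φ p.2| < ε / (2 * C + 1) := by
      rw [← Real.dist_eq]
      exact hφδ (by rw [dist_eq_norm]; exact h.trans hnδ)
    calc |φ p.1 - φ p.2| * ‖g n (p.1 - p.2) - G (p.1 - p.2)‖
        ≤ (ε / (2 * C + 1)) * (2 * C) := by
          refine mul_le_mul hd.le ?_ (norm_nonneg _) (by positivity)
          linarith [norm_sub_le (g n (p.1 - p.2)) (G (p.1 - p.2)), hg n hn (p.1 - p.2),
            hG (p.1 - p.2)]
      _ < ε := by
          rw [div_mul_eq_mul_div, div_lt_iff₀ (by positivity)]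
          nlinarith

/-- Integrals of uniformly converging integrands have the same limit as those of the limiting
integrand, along any sequence of probability measures. -/
theorem tendsto_integral_of_tendstoUniformly {X F : Type*} [MeasurableSpace X]
    [NormedAddCommGroup F] [NormedSpace ℝ F] {f : ℕ → X → F} {f₀ : X → F} {L : F}
    {μ : ℕ → Measure X} (hμ : ∀ n, IsProbabilityMeasure (μ n))
    (hf : ∀ᶠ n in atTop, Integrable (f n) (μ n)) (hf₀ : ∀ n, Integrable f₀ (μ n))
    (hunif : TendstoUniformly f f₀ atTop)
    (hlim : Tendsto (fun n => ∫ x, f₀ x ∂(μ n)) atTop (𝓝 L)) :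
    Tendsto (fun n => ∫ x, f n x ∂(μ n)) atTop (𝓝 L) := by
  have h0 : Tendsto (fun n => ∫ x, f n x ∂(μ n) - ∫ x, f₀ x ∂(μ n)) atTop (𝓝 0) := by
    rw [Metric.tendsto_nhds]
    intro ε hε
    filter_upwards [hf, Metric.tendstoUniformly_iff.mp hunif (ε / 2) (half_pos hε)]
      with n hn hclose
    rw [dist_zero_right, ← integral_sub hn (hf₀ n)]
    have hb : ‖∫ x, (f n x - f₀ x) ∂(μ n)‖ ≤ ε / 2 * (μ n).real Set.univ := by
      refine norm_integral_le_of_norm_le_const (Eventually.of_forall fun x => ?_)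
      rw [← dist_eq_norm, dist_comm]
      exact (hclose x).le
    rw [probReal_univ, mul_one] at hb
    linarith
  simpa using h0.add hlim

/-- Narrow convergence tests against bounded continuous functions with values in a Euclidean
space. -/
theorem tendsto_integral_euclideanSpace {X ι : Type*} [Fintype ι] [TopologicalSpace X]
    [MeasurableSpace X] [OpensMeasurableSpace X] {μ : ℕ → ProbabilityMeasure X}
    {μ₀ : ProbabilityMeasure X} (hμ : Tendsto μ atTop (𝓝 μ₀)) {f : X → EuclideanSpace ℝ ι}
    (hf : Continuous f) {B : ℝ} (hB : ∀ x, ‖f x‖ ≤ B) :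
    Tendsto (fun n => ∫ x, f x ∂(μ n : Measure X)) atTop (𝓝 (∫ x, f x ∂(μ₀ : Measure X))) := by
  have hcoord (i : ι) : Continuous fun x => f x i := by fun_prop
  have hbound (i : ι) (x : X) : ‖f x i‖ ≤ B := (PiLp.norm_apply_le (f x) i).trans (hB x)
  have hint (ν : ProbabilityMeasure X) (i : ι) : Integrable (fun x => f x i) (ν : Measure X) :=
    Integrable.of_bound (hcoord i).measurable.aestronglyMeasurable B
      (Eventually.of_forall (hbound i))
  have heval (ν : ProbabilityMeasure X) (i : ι) :
      (∫ x, f x ∂(ν : Measure X)) i = ∫ x, f x i ∂(ν : Measure X) :=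
    eval_integral_piLp (hint ν) i
  rw [(PiLp.homeomorph 2 fun _ : ι => ℝ).isInducing.tendsto_nhds_iff, tendsto_pi_nhds]
  intro i
  have h := ProbabilityMeasure.tendsto_iff_forall_integral_tendsto.mp hμ
    (BoundedContinuousFunction.ofNormedAddCommGroup (fun x => f x i) (hcoord i) B (hbound i))
  have hfun : (fun n => (∫ x, f x ∂(μ n : Measure X)) i) =
      fun n => ∫ x, f x i ∂(μ n : Measure X) := funext fun n => heval (μ n) i
  change Tendsto (fun n => (∫ x, f x ∂(μ n : Measure X)) i) atTop
    (𝓝 ((∫ x, f x ∂(μ₀ : Measure X)) i))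
  rw [hfun, heval]
  exact h

/-- stability of the nonlinear term. If `W_n` are smooth even `λ`-convex
potentials approximating the pointy potential `W` uniformly away from the origin, and
`ρ_n → ρ` narrowly (as probability measures), then for every continuous compactly supported
`φ`, `∬ φ(x) ∇W_n(x−y) ρ_n(dx)ρ_n(dy) → ∬_{off-diagonal} φ(x) ∇W(x−y) ρ(dx)ρ(dy)`. -/
theorem flux_stability
    {d : ℕ} (W : EuclideanSpace ℝ (Fin d) → ℝ) (winf lam : ℝ)
    (hW : PointyPotential d W winf lam)
    (Wn : ℕ → EuclideanSpace ℝ (Fin d) → ℝ)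
    (hWn : ∀ n : ℕ, 1 ≤ n → SmoothApproxPotential d (Wn n) winf lam)
    (happrox : ∀ n : ℕ, 1 ≤ n → ∀ x : EuclideanSpace ℝ (Fin d), (1 : ℝ) / n ≤ ‖x‖ →
      ‖gradient (Wn n) x - gradient W x‖ ≤ 1 / n)
    (ρn : ℕ → Measure (EuclideanSpace ℝ (Fin d)))
    (ρ : Measure (EuclideanSpace ℝ (Fin d)))
    (hρn : ∀ n, IsProbabilityMeasure (ρn n)) (hρ : IsProbabilityMeasure ρ)
    (hnarrow : ∀ f : BoundedContinuousFunction (EuclideanSpace ℝ (Fin d)) ℝ,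
      Tendsto (fun n => ∫ x, f x ∂(ρn n)) atTop (𝓝 (∫ x, f x ∂ρ))) :
    ∀ φ : EuclideanSpace ℝ (Fin d) → ℝ, Continuous φ → HasCompactSupport φ →
      Tendsto
        (fun n => ∫ p : EuclideanSpace ℝ (Fin d) × EuclideanSpace ℝ (Fin d),
          φ p.1 • gradient (Wn n) (p.1 - p.2) ∂((ρn n).prod (ρn n)))
        atTop
        (𝓝 (∫ p in {p : EuclideanSpace ℝ (Fin d) × EuclideanSpace ℝ (Fin d) | p.1 ≠ p.2},
          φ p.1 • gradient W (p.1 - p.2) ∂(ρ.prod ρ))) := by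
  intro φ hφ hφs
  have hodd := gradient_neg_of_even hW.even
  have hbound (x : EuclideanSpace ℝ (Fin d)) : ‖gradient W x‖ ≤ winf := by
    by_cases hx : x = 0
    · rw [hx, gradient_zero_of_even hW.even, norm_zero]
      exact hW.winf_nonneg
    · exact hW.gradBound x hx
  obtain ⟨M, hφM⟩ := hφs.exists_bound_of_continuous hφ
  simp only [Real.norm_eq_abs] at hφM
  have hunif := tendstoUniformly_sub_smul_comp_sub (fun n hn => (hWn n hn).gradBound) hbound
    happrox (hφs.uniformContinuous_of_continuous hφ) hφM
  have hcont := continuous_sub_smul_comp_sub hW.gradContinuous hbound hφ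
  have hsmul (p : EuclideanSpace ℝ (Fin d) × EuclideanSpace ℝ (Fin d))
      {v : EuclideanSpace ℝ (Fin d)} (hv : ‖v‖ ≤ winf) :
      ‖(φ p.1 - φ p.2) • v‖ ≤ (2 * M) * winf := by
    rw [norm_smul, Real.norm_eq_abs]
    have h : |φ p.1 - φ p.2| ≤ 2 * M := by
      linarith [abs_sub (φ p.1) (φ p.2), hφM p.1, hφM p.2]
    exact mul_le_mul h hv (norm_nonneg _) ((abs_nonneg _).trans h)
  have hρlim : Tendsto (β := ProbabilityMeasure (EuclideanSpace ℝ (Fin d)))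
      (fun n => ⟨ρn n, hρn n⟩) atTop (𝓝 ⟨ρ, hρ⟩) :=
    ProbabilityMeasure.tendsto_iff_forall_integral_tendsto.mpr hnarrow
  have hprod := (ProbabilityMeasure.continuous_prod.tendsto _).comp (hρlim.prodMk_nhds hρlim)
  have hlim := tendsto_integral_euclideanSpace hprod hcont fun p => hsmul p (hbound _)
  have hsym : Tendsto (fun n => ∫ p : EuclideanSpace ℝ (Fin d) × EuclideanSpace ℝ (Fin d),
      (φ p.1 - φ p.2) • gradient (Wn n) (p.1 - p.2) ∂((ρn n).prod (ρn n))) atTop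
      (𝓝 (∫ p : EuclideanSpace ℝ (Fin d) × EuclideanSpace ℝ (Fin d),
        (φ p.1 - φ p.2) • gradient W (p.1 - p.2) ∂(ρ.prod ρ))) := by
    refine tendsto_integral_of_tendstoUniformly (fun n => inferInstance) ?_ (fun n => ?_) hunif hlim
    · filter_upwards [eventually_ge_atTop 1] with n hn
      refine Integrable.of_bound (C := (2 * M) * winf) ?_ (Eventually.of_forall fun p => ?_)
      · exact (((hφ.measurable.comp measurable_fst).sub (hφ.measurable.comp measurable_snd)).smul
          ((measurable_gradient (Wn n)).comp
            (measurable_fst.sub measurable_snd))).aestronglyMeasurable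
      · exact hsmul p ((hWn n hn).gradBound _)
    · exact Integrable.of_bound hcont.measurable.aestronglyMeasurable _
        (Eventually.of_forall fun p => hsmul p (hbound _))
  have hoff : ∫ p in {p : EuclideanSpace ℝ (Fin d) × EuclideanSpace ℝ (Fin d) | p.1 ≠ p.2},
      φ p.1 • gradient W (p.1 - p.2) ∂(ρ.prod ρ) =
      ∫ p : EuclideanSpace ℝ (Fin d) × EuclideanSpace ℝ (Fin d),
        φ p.1 • gradient W (p.1 - p.2) ∂(ρ.prod ρ) := by
    refine setIntegral_eq_integral_of_forall_compl_eq_zero fun p hp => ?_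
    rw [not_not.mp hp, sub_self, gradient_zero_of_even hW.even, smul_zero]
  rw [integral_sub_smul_comp_sub (measurable_gradient W) hbound hodd hφ hφM ρ] at hsym
  rw [hoff]
  have hhalf := hsym.const_smul (2⁻¹ : ℝ)
  rw [inv_smul_smul₀ two_ne_zero] at hhalf
  refine hhalf.congr' ?_
  filter_upwards [eventually_ge_atTop 1] with n hn
  rw [integral_sub_smul_comp_sub (measurable_gradient (Wn n)) (hWn n hn).gradBound
    (gradient_neg_of_even (hWn n hn).even) hφ hφM (ρn n), inv_smul_smul₀ two_ne_zero]
end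
end

section
/- Let W : ℝ^d → ℝ satisfy assumptions (A0)–(A2), let ρ^ini ∈ 𝒫₂(ℝ^d), and let T > 0. Then there exists a Filippov-flow solution (X, ρ) of the aggregation equation on [0,T] with initial datum ρ^ini. Moreover ρ is a distributional solution: for every φ ∈ C_c^∞((0,T) × ℝ^d), ∫₀^T ∫_{ℝ^d} ( ∂_t φ(t,x) + â_ρ(t,x) · ∇φ(t,x) ) ρ(t,dx) dt = 0, where â_ρ(t,x) = −∫ ∇̂W(x − y) ρ(t,dy), and sup_{t∈[0,T]} ∫ |x|² ρ(t,dx) < ∞. -/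
open MeasureTheory Filter Metric
open scoped RealInnerProductSpace Topology BigOperators NNReal ENNReal Classical

noncomputable section

/-- The velocity field `â_ρ(x) = −∫ ∇̂W(x − y) ρ(dy)`. -/
def aHat (d : ℕ) (W : EuclideanSpace ℝ (Fin d) → ℝ) (μ : Measure (EuclideanSpace ℝ (Fin d)))
    (x : EuclideanSpace ℝ (Fin d)) : EuclideanSpace ℝ (Fin d) :=
  -∫ y, hatGrad d W (x - y) ∂μ

/-- `μ ∈ 𝒫₂(ℝ^d)`: a Borel probability measure with finite second moment. -/
def MemP2 {d : ℕ} (μ : Measure (EuclideanSpace ℝ (Fin d))) : Prop :=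
  IsProbabilityMeasure μ ∧ Integrable (fun x => ‖x‖ ^ 2) μ

/-- The essential convex hull of a vector field `b` at a point `x`:
`⋂_{r>0} ⋂_{N null} conv(b(B(x,r) \ N))`. -/
def convEss (d : ℕ) (b : EuclideanSpace ℝ (Fin d) → EuclideanSpace ℝ (Fin d))
    (x : EuclideanSpace ℝ (Fin d)) : Set (EuclideanSpace ℝ (Fin d)) :=
  ⋂ r ∈ Set.Ioi (0 : ℝ), ⋂ N ∈ {N : Set (EuclideanSpace ℝ (Fin d)) | volume N = 0},
    closure (convexHull ℝ (b '' (Metric.ball x r \ N)))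

/-- `X` is a Filippov characteristic on `[0,T]` of the time-dependent vector field `b`
stemming from the point `x` at time `s`: `X` is continuous on `[0,T]`, `X s = x`, and for
a.e. `t ∈ [0,T]`, `X` is differentiable at `t` with derivative in the essential convex hull
of `b t` at `X t`. -/
def FilippovChar (d : ℕ) (T : ℝ) (b : ℝ → EuclideanSpace ℝ (Fin d) → EuclideanSpace ℝ (Fin d))
    (s : ℝ) (x : EuclideanSpace ℝ (Fin d)) (X : ℝ → EuclideanSpace ℝ (Fin d)) : Prop :=
  ContinuousOn X (Set.Icc 0 T) ∧ X s = x ∧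
    ∀ᵐ t ∂(volume.restrict (Set.Icc (0 : ℝ) T)),
      ∃ v, HasDerivAt X v t ∧ v ∈ convEss d (b t) (X t)

/-- `(X, ρ)` is a Filippov-flow solution of the aggregation equation
`∂_t ρ = div((∇W∗ρ)ρ)` on `[0,T]` with initial datum `ρini`: for every `t ∈ [0,T]`,
`ρ t ∈ 𝒫₂(ℝ^d)`, `t ↦ ρ t` is continuous for the weak topology of measures, `X t` is
measurable with `ρ t = X(t,·)_# ρini`, and for every `x`, `X(·,x)` is a Filippov
characteristic of the velocity field `â_ρ` stemming from `x` at time `0`. -/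
def IsFilippovSolution (d : ℕ) (W : EuclideanSpace ℝ (Fin d) → ℝ) (T : ℝ)
    (ρini : Measure (EuclideanSpace ℝ (Fin d)))
    (X : ℝ → EuclideanSpace ℝ (Fin d) → EuclideanSpace ℝ (Fin d))
    (ρ : ℝ → Measure (EuclideanSpace ℝ (Fin d))) : Prop :=
  (∀ t ∈ Set.Icc (0 : ℝ) T, MemP2 (ρ t)) ∧
  (∀ f : BoundedContinuousFunction (EuclideanSpace ℝ (Fin d)) ℝ,
    ContinuousOn (fun t => ∫ x, f x ∂(ρ t)) (Set.Icc (0 : ℝ) T)) ∧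
  (∀ t ∈ Set.Icc (0 : ℝ) T, Measurable (X t)) ∧
  (∀ t ∈ Set.Icc (0 : ℝ) T, ρ t = ρini.map (X t)) ∧
  (∀ x : EuclideanSpace ℝ (Fin d),
    FilippovChar d T (fun t y => aHat d W (ρ t) y) 0 x (fun t => X t x))

lemma integrable_of_norm_le {α : Type*} [MeasurableSpace α] {ν : Measure α} [IsFiniteMeasure ν]
    {F : Type*} [NormedAddCommGroup F] [MeasurableSpace F] [BorelSpace F]
    [SecondCountableTopology F] {f : α → F} (hf : Measurable f) {C : ℝ}
    (hC : ∀ x, ‖f x‖ ≤ C) : Integrable f ν :=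
  Integrable.of_bound hf.aestronglyMeasurable C (.of_forall hC)

section EulerScheme

variable {E : Type*} [NormedAddCommGroup E] [InnerProductSpace ℝ E]
  [MeasurableSpace E]

/-- `g` is a bounded odd measurable selection of the subdifferential of the `(-L)`-convex,
`w`-Lipschitz function `W`, continuous away from the origin. -/
structure SubgradientSelection (W : E → ℝ) (g : E → E) (w L : ℝ) : Prop where
  w_nonneg : 0 ≤ w
  L_nonneg : 0 ≤ L
  measurable : Measurable g
  odd : ∀ x, g (-x) = -g x
  norm_le : ∀ x, ‖g x‖ ≤ w
  continuousAt : ∀ x, x ≠ 0 → ContinuousAt g x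
  lipschitz : ∀ a b, |W a - W b| ≤ w * ‖a - b‖
  subgradient : ∀ a b, W a + ⟪g a, b - a⟫ - L / 2 * ‖b - a‖ ^ 2 ≤ W b

/-- The velocity at the particle `x` of the configuration `Y`. -/
def flowVel (μ : Measure E) (g : E → E) (Y : E → E) (x : E) : E := -∫ y, g (Y x - Y y) ∂μ

/-- The explicit Euler scheme with step `h`. -/
def euler (μ : Measure E) (g : E → E) (h : ℝ) : ℕ → E → E
  | 0 => id
  | k + 1 => fun x => euler μ g h k x + h • flowVel μ g (euler μ g h k) x

variable {W : E → ℝ} {g : E → E} {w L : ℝ} {μ : Measure E}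

lemma SubgradientSelection.monotone (hg : SubgradientSelection W g w L) (a b : E) :
    -L * ‖a - b‖ ^ 2 ≤ ⟪g a - g b, a - b⟫ := by
  have h1 := hg.subgradient a b
  have h2 := hg.subgradient b a
  rw [norm_sub_rev b a] at h1
  have h3 : ⟪g a, b - a⟫ = -⟪g a, a - b⟫ := by rw [← inner_neg_right, neg_sub]
  rw [inner_sub_left]
  linarith

lemma SubgradientSelection.continuous_potential (hg : SubgradientSelection W g w L) :
    Continuous W := by
  refine (LipschitzWith.of_dist_le_mul (K := ⟨w, hg.w_nonneg⟩) fun a b => ?_).continuous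
  rw [Real.dist_eq, dist_eq_norm]
  exact hg.lipschitz a b

variable [IsProbabilityMeasure μ]

lemma SubgradientSelection.norm_flowVel_le (hg : SubgradientSelection W g w L) (Y : E → E)
    (x : E) : ‖flowVel μ g Y x‖ ≤ w := by
  rw [flowVel, norm_neg]
  simpa using norm_integral_le_of_norm_le_const (μ := μ) (f := fun y => g (Y x - Y y))
    (.of_forall fun _ => hg.norm_le _)

variable [FiniteDimensional ℝ E] [BorelSpace E]

lemma SubgradientSelection.integrable (hg : SubgradientSelection W g w L) {Y : E → E}
    (hY : Measurable Y) (x : E) : Integrable (fun y => g (x - Y y)) μ :=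
  Integrable.of_bound (hg.measurable.comp (hY.const_sub x)).aestronglyMeasurable w
    (.of_forall fun _ => hg.norm_le _)

lemma SubgradientSelection.measurable_flowVel (hg : SubgradientSelection W g w L) {Y : E → E}
    (hY : Measurable Y) : Measurable (flowVel μ g Y) := by
  have h : StronglyMeasurable (fun p : E × E => g (Y p.1 - Y p.2)) :=
    (hg.measurable.comp
      ((hY.comp measurable_fst).sub (hY.comp measurable_snd))).stronglyMeasurable
  exact h.integral_prod_right.measurable.neg

lemma SubgradientSelection.inner_flowVel (hg : SubgradientSelection W g w L) {Y : E → E}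
    (hY : Measurable Y) (u x : E) :
    ⟪u, flowVel μ g Y x⟫ = -∫ y, ⟪u, g (Y x - Y y)⟫ ∂μ := by
  rw [flowVel, inner_neg_right, integral_inner (hg.integrable hY _)]

lemma SubgradientSelection.measurable_euler (hg : SubgradientSelection W g w L) (h : ℝ) (k : ℕ) :
    Measurable (euler μ g h k) := by
  induction k with
  | zero => exact measurable_id
  | succ k ih => exact ih.add ((hg.measurable_flowVel ih).const_smul h)

omit [FiniteDimensional ℝ E] [BorelSpace E] in
lemma SubgradientSelection.norm_euler_sub_le (hg : SubgradientSelection W g w L) {h : ℝ}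
    (hh : 0 ≤ h) (k j : ℕ) (x : E) :
    ‖euler μ g h (k + j) x - euler μ g h k x‖ ≤ w * (j * h) := by
  induction j with
  | zero => simp
  | succ j ih =>
    have h1 : euler μ g h (k + (j + 1)) x = euler μ g h (k + j) x
      + h • flowVel μ g (euler μ g h (k + j)) x := rfl
    rw [h1, add_sub_right_comm]
    refine (norm_add_le _ _).trans ?_
    rw [norm_smul, Real.norm_of_nonneg hh]
    have := mul_le_mul_of_nonneg_left (hg.norm_flowVel_le (μ := μ) (euler μ g h (k + j)) x) hh
    push_cast
    linarith

/-- Pairing a difference of velocities with the difference of the configurations, one particle. -/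
lemma SubgradientSelection.inner_flowVel_sub_le (hg : SubgradientSelection W g w L) {Y Z : E → E}
    (hY : Measurable Y) (hZ : Measurable Z) {B : ℝ} (hB : ∀ x, ‖Y x - Z x‖ ≤ B) (x : E) :
    ⟪Y x - Z x, flowVel μ g Y x - flowVel μ g Z x⟫ ≤
      2 * L * ‖Y x - Z x‖ ^ 2 + 2 * L * (∫ y, ‖Y y - Z y‖ ^ 2 ∂μ)
        + 2 * w * ∫ y, ‖Y y - Z y‖ ∂μ := by
  have hD : Measurable fun y => ‖Y y - Z y‖ := (hY.sub hZ).norm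
  have hi1 : Integrable (fun y => ‖Y y - Z y‖) μ :=
    integrable_of_norm_le hD (C := B) fun y => by simpa using hB y
  have hi2 : Integrable (fun y => ‖Y y - Z y‖ ^ 2) μ :=
    integrable_of_norm_le (hD.pow_const 2) (C := B ^ 2) fun y => by
      rw [norm_pow, norm_norm]
      exact pow_le_pow_left₀ (norm_nonneg _) (hB y) 2
  have hiY : Integrable (fun y => ⟪Y x - Z x, g (Y x - Y y)⟫) μ :=
    (hg.integrable hY (Y x)).const_inner _
  have hiZ : Integrable (fun y => ⟪Y x - Z x, g (Z x - Z y)⟫) μ :=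
    (hg.integrable hZ (Z x)).const_inner _
  rw [inner_sub_right, hg.inner_flowVel hY, hg.inner_flowVel hZ, sub_eq_add_neg, neg_neg,
    neg_add_eq_sub, ← integral_sub hiZ hiY]
  calc _ ≤ ∫ y, ((2 * L * ‖Y x - Z x‖ ^ 2 + 2 * L * ‖Y y - Z y‖ ^ 2)
        + 2 * w * ‖Y y - Z y‖) ∂μ := by
        refine integral_mono (hiZ.sub hiY)
          (((integrable_const _).add (hi2.const_mul _)).add (hi1.const_mul _)) fun y => ?_
        have h1 := hg.monotone (Y x - Y y) (Z x - Z y)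
        have h2 : Y x - Y y - (Z x - Z y) = (Y x - Z x) - (Y y - Z y) := by abel
        rw [h2, inner_sub_right, inner_sub_left] at h1
        have h3 : ‖(Y x - Z x) - (Y y - Z y)‖ ^ 2 ≤ 2 * ‖Y x - Z x‖ ^ 2 + 2 * ‖Y y - Z y‖ ^ 2 := by
          have := parallelogram_law_with_norm ℝ (Y x - Z x) (Y y - Z y)
          nlinarith [sq_nonneg ‖(Y x - Z x) + (Y y - Z y)‖]
        have h4 := mul_le_mul_of_nonneg_left h3 hg.L_nonneg
        have h5 := abs_le.1 (abs_real_inner_le_norm (g (Y x - Y y) - g (Z x - Z y)) (Y y - Z y))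
        have h6 : ‖g (Y x - Y y) - g (Z x - Z y)‖ ≤ 2 * w :=
          (norm_sub_le _ _).trans (by linarith [hg.norm_le (Y x - Y y), hg.norm_le (Z x - Z y)])
        have h7 := mul_le_mul_of_nonneg_right h6 (norm_nonneg (Y y - Z y))
        have h8 := real_inner_comm (Y x - Z x) (g (Y x - Y y))
        have h9 := real_inner_comm (Y x - Z x) (g (Z x - Z y))
        linarith [h5.1, h5.2]
    _ = _ := by
        have hi3 : Integrable (fun y => 2 * L * ‖Y x - Z x‖ ^ 2 + 2 * L * ‖Y y - Z y‖ ^ 2) μ :=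
          (integrable_const _).add (hi2.const_mul _)
        rw [integral_add hi3 (hi1.const_mul _),
          integral_add (integrable_const _) (hi2.const_mul _)]
        simp [integral_const_mul]

/-- Exchanging the two particles antisymmetrizes the pairing of the velocity with a field. -/
lemma SubgradientSelection.integral_inner_flowVel (hg : SubgradientSelection W g w L)
    {Y D : E → E} (hY : Measurable Y) (hD : Measurable D) {B : ℝ} (hB : ∀ x, ‖D x‖ ≤ B) :
    ∫ x, ⟪D x, flowVel μ g Y x⟫ ∂μ =
      -(1 / 2) * ∫ p : E × E, ⟪D p.1 - D p.2, g (Y p.1 - Y p.2)⟫ ∂(μ.prod μ) := by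
  have hm : Measurable fun p : E × E => g (Y p.1 - Y p.2) :=
    hg.measurable.comp ((hY.comp measurable_fst).sub (hY.comp measurable_snd))
  have key : ∀ D' : E × E → E, Measurable D' → (∀ p, ‖D' p‖ ≤ B) →
      Integrable (fun p : E × E => ⟪D' p, g (Y p.1 - Y p.2)⟫) (μ.prod μ) := by
    intro D' hD' hB'
    refine integrable_of_norm_le (hD'.inner hm) (C := B * w) fun p => ?_
    refine (norm_inner_le_norm _ _).trans ?_
    exact mul_le_mul (hB' p) (hg.norm_le _) (norm_nonneg _) ((norm_nonneg _).trans (hB' p))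
  have h1 := key (fun p => D p.1) (hD.comp measurable_fst) fun p => hB _
  have h2 := key (fun p => D p.2) (hD.comp measurable_snd) fun p => hB _
  have e1 : ∫ x, ⟪D x, flowVel μ g Y x⟫ ∂μ
      = -∫ p : E × E, ⟪D p.1, g (Y p.1 - Y p.2)⟫ ∂(μ.prod μ) := by
    rw [integral_prod _ h1, ← integral_neg]
    exact integral_congr_ae (.of_forall fun x => hg.inner_flowVel hY _ _)
  have e2 : ∫ p : E × E, ⟪D p.2, g (Y p.1 - Y p.2)⟫ ∂(μ.prod μ)
      = -∫ p : E × E, ⟪D p.1, g (Y p.1 - Y p.2)⟫ ∂(μ.prod μ) := by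
    rw [← integral_prod_swap, ← integral_neg]
    refine integral_congr_ae (.of_forall fun p => ?_)
    simp only [Prod.fst_swap, Prod.snd_swap]
    rw [← neg_sub, hg.odd, inner_neg_right]
  simp only [inner_sub_left]
  rw [integral_sub h1 h2, e1, e2]
  ring

/-- Pairing a difference of velocities with the difference of the configurations, in mean. -/
lemma SubgradientSelection.integral_inner_flowVel_sub_le (hg : SubgradientSelection W g w L)
    {Y Z : E → E} (hY : Measurable Y) (hZ : Measurable Z) {B : ℝ} (hB : ∀ x, ‖Y x - Z x‖ ≤ B) :
    ∫ x, ⟪Y x - Z x, flowVel μ g Y x - flowVel μ g Z x⟫ ∂μ ≤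
      2 * L * ∫ y, ‖Y y - Z y‖ ^ 2 ∂μ := by
  have hD : Measurable fun y => Y y - Z y := hY.sub hZ
  have hB0 : 0 ≤ B := (norm_nonneg _).trans (hB 0)
  have hi2 : Integrable (fun y => ‖Y y - Z y‖ ^ 2) μ :=
    integrable_of_norm_le (hD.norm.pow_const 2) (C := B ^ 2) fun y => by
      rw [norm_pow, norm_norm]
      exact pow_le_pow_left₀ (norm_nonneg _) (hB y) 2
  have hv : ∀ V : E → E, Measurable V → Integrable (fun x => ⟪Y x - Z x, flowVel μ g V x⟫) μ :=
    fun V hV => integrable_of_norm_le (hD.inner (hg.measurable_flowVel hV)) (C := B * w) fun x =>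
      (norm_inner_le_norm _ _).trans
        (mul_le_mul (hB x) (hg.norm_flowVel_le _ _) (norm_nonneg _) hB0)
  have hp : ∀ V : E → E, Measurable V → Integrable (fun p : E × E =>
      ⟪(Y p.1 - Z p.1) - (Y p.2 - Z p.2), g (V p.1 - V p.2)⟫) (μ.prod μ) := by
    intro V hV
    refine integrable_of_norm_le (C := 2 * B * w) (Measurable.inner
      ((hD.comp measurable_fst).sub (hD.comp measurable_snd)) (hg.measurable.comp
      ((hV.comp measurable_fst).sub (hV.comp measurable_snd)))) fun p =>
      (norm_inner_le_norm _ _).trans (mul_le_mul ((norm_sub_le _ _).trans ?_) (hg.norm_le _)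
      (norm_nonneg _) (by positivity))
    linarith [hB p.1, hB p.2]
  simp only [inner_sub_right]
  rw [integral_sub (hv Y hY) (hv Z hZ), hg.integral_inner_flowVel hY hD hB,
    hg.integral_inner_flowVel hZ hD hB, ← mul_sub, ← integral_sub (hp Y hY) (hp Z hZ)]
  have hi1 : Integrable (fun p : E × E => ‖Y p.1 - Z p.1‖ ^ 2) (μ.prod μ) := hi2.comp_fst μ
  have hi3 : Integrable (fun p : E × E => ‖Y p.2 - Z p.2‖ ^ 2) (μ.prod μ) := hi2.comp_snd μ
  have hle : ∫ p : E × E, (-(2 * L) * ‖Y p.1 - Z p.1‖ ^ 2 + -(2 * L) * ‖Y p.2 - Z p.2‖ ^ 2)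
      ∂(μ.prod μ) ≤ ∫ p : E × E, (⟪(Y p.1 - Z p.1) - (Y p.2 - Z p.2), g (Y p.1 - Y p.2)⟫
        - ⟪(Y p.1 - Z p.1) - (Y p.2 - Z p.2), g (Z p.1 - Z p.2)⟫) ∂(μ.prod μ) := by
    refine integral_mono ((hi1.const_mul _).add (hi3.const_mul _)) ((hp Y hY).sub (hp Z hZ))
      fun p => ?_
    have h1 := hg.monotone (Y p.1 - Y p.2) (Z p.1 - Z p.2)
    have h2 : Y p.1 - Y p.2 - (Z p.1 - Z p.2) = (Y p.1 - Z p.1) - (Y p.2 - Z p.2) := by abel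
    rw [h2, real_inner_comm, inner_sub_right] at h1
    have h3 : ‖(Y p.1 - Z p.1) - (Y p.2 - Z p.2)‖ ^ 2
        ≤ 2 * ‖Y p.1 - Z p.1‖ ^ 2 + 2 * ‖Y p.2 - Z p.2‖ ^ 2 := by
      have := parallelogram_law_with_norm ℝ (Y p.1 - Z p.1) (Y p.2 - Z p.2)
      nlinarith [sq_nonneg ‖(Y p.1 - Z p.1) + (Y p.2 - Z p.2)‖]
    have h4 := mul_le_mul_of_nonneg_left h3 hg.L_nonneg
    linarith
  rw [integral_add (hi1.const_mul _) (hi3.const_mul _), integral_const_mul,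
    integral_const_mul, integral_fun_fst (fun x => ‖Y x - Z x‖ ^ 2),
    integral_fun_snd (fun x => ‖Y x - Z x‖ ^ 2)] at hle
  simp only [probReal_univ, one_smul] at hle
  linarith

lemma le_of_discrete_gronwall {a : ℕ → ℝ} {α β h : ℝ} (hα : 0 ≤ α) (hβ : 0 ≤ β) (hh : 0 ≤ h)
    (h0 : a 0 ≤ 0) {N : ℕ} (hrec : ∀ j < N, a (j + 1) ≤ (1 + α * h) * a j + h * β) :
    ∀ j ≤ N, a j ≤ j * h * β * Real.exp (α * (j * h)) := by
  intro j
  induction j with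
  | zero => intro _; simpa using h0
  | succ j ih =>
    intro hj
    have h1 := ih (by omega)
    have h2 : 1 + α * h ≤ Real.exp (α * h) := by linarith [Real.add_one_le_exp (α * h)]
    have h3 : Real.exp (α * ((j + 1 : ℕ) * h)) = Real.exp (α * h) * Real.exp (α * (j * h)) := by
      rw [← Real.exp_add]; congr 1; push_cast; ring
    have h4 : (1 : ℝ) ≤ Real.exp (α * ((j + 1 : ℕ) * h)) := Real.one_le_exp (by positivity)
    have h5 : (1 + α * h) * a j ≤ Real.exp (α * h) * (j * h * β * Real.exp (α * (j * h))) :=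
      (mul_le_mul_of_nonneg_left h1 (by positivity)).trans
        (mul_le_mul_of_nonneg_right h2 (by positivity))
    have h6 : h * β ≤ h * β * Real.exp (α * ((j + 1 : ℕ) * h)) :=
      le_mul_of_one_le_right (by positivity) h4
    calc a (j + 1) ≤ _ := hrec j (by omega)
      _ ≤ Real.exp (α * h) * (j * h * β * Real.exp (α * (j * h)))
          + h * β * Real.exp (α * ((j + 1 : ℕ) * h)) := add_le_add h5 h6
      _ = _ := by rw [h3]; push_cast; ring

/-- A scheme with step `h` whose velocity is evaluated at a nearby configuration `P j`. -/
structure PerturbedEuler (μ : Measure E) (g : E → E) (w h : ℝ) (A P : ℕ → E → E) : Prop where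
  measurable : ∀ j, Measurable (P j)
  zero : ∀ x, A 0 x = x
  succ : ∀ j x, A (j + 1) x = A j x + h • flowVel μ g (P j) x
  near : ∀ j x, ‖A j x - P j x‖ ≤ w * h

section Perturbed

variable {h : ℝ} {A P B Q : ℕ → E → E}

lemma PerturbedEuler.measurable_fst (hg : SubgradientSelection W g w L)
    (hA : PerturbedEuler μ g w h A P) (j : ℕ) : Measurable (A j) := by
  induction j with
  | zero =>
    have : A 0 = id := funext hA.zero
    rw [this]; exact measurable_id
  | succ j ih =>
    rw [funext (hA.succ j)]
    exact ih.add ((hg.measurable_flowVel (hA.measurable j)).const_smul h)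

omit [FiniteDimensional ℝ E] [BorelSpace E] in
lemma PerturbedEuler.norm_fst_sub_le (hg : SubgradientSelection W g w L)
    (hA : PerturbedEuler μ g w h A P) (hB : PerturbedEuler μ g w h B Q) (hh : 0 ≤ h)
    (j : ℕ) (x : E) : ‖A j x - B j x‖ ≤ 2 * w * h * j := by
  induction j with
  | zero => simp [hA.zero, hB.zero]
  | succ j ih =>
    have e : A (j + 1) x - B (j + 1) x
        = (A j x - B j x) + h • (flowVel μ g (P j) x - flowVel μ g (Q j) x) := by
      rw [hA.succ, hB.succ, smul_sub]; abel
    rw [e]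
    refine (norm_add_le _ _).trans ?_
    rw [norm_smul, Real.norm_of_nonneg hh]
    have h1 := norm_sub_le (flowVel μ g (P j) x) (flowVel μ g (Q j) x)
    have h2 := hg.norm_flowVel_le (μ := μ) (P j) x
    have h3 := hg.norm_flowVel_le (μ := μ) (Q j) x
    have h4 := mul_le_mul_of_nonneg_left (h1.trans (add_le_add h2 h3)) hh
    push_cast
    linarith

omit [InnerProductSpace ℝ E] [MeasurableSpace E] [FiniteDimensional ℝ E] [BorelSpace E] in
lemma norm_sub_sub_sub_le {a b p q : E} {c : ℝ} (h1 : ‖a - p‖ ≤ c) (h2 : ‖b - q‖ ≤ c) :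
    ‖(a - b) - (p - q)‖ ≤ 2 * c := by
  have : (a - b) - (p - q) = (a - p) - (b - q) := by abel
  rw [this]
  exact (norm_sub_le _ _).trans (by linarith)

omit [InnerProductSpace ℝ E] [MeasurableSpace E] [FiniteDimensional ℝ E] [BorelSpace E] in
lemma sq_norm_le_of_norm_sub_le {u v : E} {c : ℝ} (h : ‖u - v‖ ≤ 2 * c) :
    ‖v‖ ^ 2 ≤ 2 * ‖u‖ ^ 2 + 8 * c ^ 2 := by
  have h1 : ‖v‖ ≤ ‖u‖ + 2 * c := by
    have := norm_sub_norm_le v u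
    rw [norm_sub_rev] at this
    linarith
  have := pow_le_pow_left₀ (norm_nonneg v) h1 2
  nlinarith [sq_nonneg (‖u‖ - 2 * c)]

omit [FiniteDimensional ℝ E] [BorelSpace E] in
lemma PerturbedEuler.sq_norm_succ_sub_le (hg : SubgradientSelection W g w L)
    (hA : PerturbedEuler μ g w h A P) (hB : PerturbedEuler μ g w h B Q) (hh : 0 ≤ h)
    (j : ℕ) (x : E) :
    ‖A (j + 1) x - B (j + 1) x‖ ^ 2 ≤ ‖A j x - B j x‖ ^ 2
      + 2 * h * ⟪P j x - Q j x, flowVel μ g (P j) x - flowVel μ g (Q j) x⟫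
      + 12 * w ^ 2 * h ^ 2 := by
  have e : A (j + 1) x - B (j + 1) x
      = (A j x - B j x) + h • (flowVel μ g (P j) x - flowVel μ g (Q j) x) := by
    rw [hA.succ, hB.succ, smul_sub]; abel
  have hw := hg.w_nonneg
  set V := flowVel μ g (P j) x - flowVel μ g (Q j) x with hV
  have hVn : ‖V‖ ≤ 2 * w := (norm_sub_le _ _).trans (by
    linarith [hg.norm_flowVel_le (μ := μ) (P j) x, hg.norm_flowVel_le (μ := μ) (Q j) x])
  have h1 := norm_sub_sub_sub_le (hA.near j x) (hB.near j x)
  have h2 : ⟪(A j x - B j x) - (P j x - Q j x), V⟫ ≤ 2 * (w * h) * (2 * w) :=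
    (real_inner_le_norm _ _).trans (mul_le_mul h1 hVn (norm_nonneg _) (by positivity))
  rw [inner_sub_left] at h2
  rw [e, norm_add_sq_real, inner_smul_right, norm_smul, Real.norm_of_nonneg hh, mul_pow]
  have h3 : ‖V‖ ^ 2 ≤ (2 * w) ^ 2 := pow_le_pow_left₀ (norm_nonneg _) hVn 2
  have h4 := mul_le_mul_of_nonneg_left h3 (sq_nonneg h)
  have h5 := mul_le_mul_of_nonneg_left h2 hh
  nlinarith

lemma PerturbedEuler.integrable_sq (hg : SubgradientSelection W g w L)
    (hA : PerturbedEuler μ g w h A P) (hB : PerturbedEuler μ g w h B Q) (hh : 0 ≤ h) (j : ℕ) :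
    Integrable (fun x => ‖A j x - B j x‖ ^ 2) μ :=
  integrable_of_norm_le (((hA.measurable_fst hg j).sub (hB.measurable_fst hg j)).norm.pow_const 2)
    (C := (2 * w * h * j) ^ 2) fun x => by
      rw [norm_pow, norm_norm]
      exact pow_le_pow_left₀ (norm_nonneg _) (hA.norm_fst_sub_le hg hB hh j x) 2

omit [FiniteDimensional ℝ E] [BorelSpace E] in
lemma PerturbedEuler.norm_snd_sub_le (hg : SubgradientSelection W g w L)
    (hA : PerturbedEuler μ g w h A P) (hB : PerturbedEuler μ g w h B Q) (hh : 0 ≤ h)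
    (j : ℕ) (x : E) : ‖P j x - Q j x‖ ≤ 2 * w * h * j + 2 * (w * h) := by
  have h1 := norm_sub_sub_sub_le (hA.near j x) (hB.near j x)
  have h2 := hA.norm_fst_sub_le hg hB hh j x
  have h3 := norm_sub_norm_le (P j x - Q j x) (A j x - B j x)
  rw [norm_sub_rev (P j x - Q j x)] at h3
  linarith

lemma PerturbedEuler.integrable_sq_snd (hg : SubgradientSelection W g w L)
    (hA : PerturbedEuler μ g w h A P) (hB : PerturbedEuler μ g w h B Q) (hh : 0 ≤ h) (j : ℕ) :
    Integrable (fun x => ‖P j x - Q j x‖ ^ 2) μ :=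
  integrable_of_norm_le (((hA.measurable j).sub (hB.measurable j)).norm.pow_const 2)
    (C := (2 * w * h * j + 2 * (w * h)) ^ 2) fun x => by
      rw [norm_pow, norm_norm]
      exact pow_le_pow_left₀ (norm_nonneg _) (hA.norm_snd_sub_le hg hB hh j x) 2

lemma PerturbedEuler.integral_sq_snd_le (hg : SubgradientSelection W g w L)
    (hA : PerturbedEuler μ g w h A P) (hB : PerturbedEuler μ g w h B Q) (hh : 0 ≤ h) (j : ℕ) :
    ∫ x, ‖P j x - Q j x‖ ^ 2 ∂μ ≤ 2 * (∫ x, ‖A j x - B j x‖ ^ 2 ∂μ) + 8 * (w * h) ^ 2 := by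
  have hi := hA.integrable_sq hg hB hh j
  calc ∫ x, ‖P j x - Q j x‖ ^ 2 ∂μ
      ≤ ∫ x, (2 * ‖A j x - B j x‖ ^ 2 + 8 * (w * h) ^ 2) ∂μ :=
        integral_mono (hA.integrable_sq_snd hg hB hh j)
          ((hi.const_mul 2).add (integrable_const _)) fun x =>
          sq_norm_le_of_norm_sub_le (norm_sub_sub_sub_le (hA.near j x) (hB.near j x))
    _ = _ := by
        rw [integral_add (hi.const_mul 2) (integrable_const _), integral_const_mul]
        simp

lemma PerturbedEuler.integral_sq_le (hg : SubgradientSelection W g w L)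
    (hA : PerturbedEuler μ g w h A P) (hB : PerturbedEuler μ g w h B Q) (hh : 0 ≤ h)
    (hh1 : h ≤ 1) (j : ℕ) :
    ∫ x, ‖A j x - B j x‖ ^ 2 ∂μ ≤
      j * h * (h * ((32 * L + 12) * w ^ 2)) * Real.exp (8 * L * (j * h)) := by
  have hL := hg.L_nonneg
  refine le_of_discrete_gronwall (a := fun j => ∫ x, ‖A j x - B j x‖ ^ 2 ∂μ) (N := j)
    (by positivity) (by positivity) hh ?_ (fun k _ => ?_) j le_rfl
  · simp [hA.zero, hB.zero]
  have hi := hA.integrable_sq hg hB hh k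
  have hv : Measurable fun x => flowVel μ g (P k) x - flowVel μ g (Q k) x :=
    (hg.measurable_flowVel (hA.measurable k)).sub (hg.measurable_flowVel (hB.measurable k))
  have hd : Measurable fun x => P k x - Q k x := (hA.measurable k).sub (hB.measurable k)
  have hin : Integrable
      (fun x => ⟪P k x - Q k x, flowVel μ g (P k) x - flowVel μ g (Q k) x⟫) μ := by
    refine integrable_of_norm_le (hd.inner hv)
      (C := (2 * w * h * k + 2 * (w * h)) * (2 * w)) fun x => ?_
    have h1 := hA.norm_snd_sub_le hg hB hh k x
    refine (norm_inner_le_norm _ _).trans (mul_le_mul h1 ?_ (norm_nonneg _)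
      ((norm_nonneg _).trans h1))
    exact (norm_sub_le _ _).trans (by
      linarith [hg.norm_flowVel_le (μ := μ) (P k) x, hg.norm_flowVel_le (μ := μ) (Q k) x])
  have hs : Integrable (fun x => ‖A k x - B k x‖ ^ 2
      + 2 * h * ⟪P k x - Q k x, flowVel μ g (P k) x - flowVel μ g (Q k) x⟫) μ :=
    hi.add (hin.const_mul _)
  have h1 : ∫ x, ‖A (k + 1) x - B (k + 1) x‖ ^ 2 ∂μ ≤ ∫ x, (‖A k x - B k x‖ ^ 2
      + 2 * h * ⟪P k x - Q k x, flowVel μ g (P k) x - flowVel μ g (Q k) x⟫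
      + 12 * w ^ 2 * h ^ 2) ∂μ :=
    integral_mono (hA.integrable_sq hg hB hh (k + 1)) (hs.add (integrable_const _))
      (hA.sq_norm_succ_sub_le hg hB hh k)
  rw [integral_add hs (integrable_const _), integral_add hi (hin.const_mul _),
    integral_const_mul, integral_const, probReal_univ, one_smul] at h1
  have h2 := hg.integral_inner_flowVel_sub_le (hA.measurable k) (hB.measurable k)
    (μ := μ) (hA.norm_snd_sub_le hg hB hh k)
  have h3 := mul_le_mul_of_nonneg_left (hA.integral_sq_snd_le hg hB hh k)
    (show 0 ≤ 2 * L by positivity)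
  have h4 := mul_le_mul_of_nonneg_left (h2.trans h3) (show 0 ≤ 2 * h by positivity)
  have h5 : 32 * L * w ^ 2 * h ^ 2 * h ≤ 32 * L * w ^ 2 * h ^ 2 * 1 :=
    mul_le_mul_of_nonneg_left hh1 (by positivity)
  linarith

lemma SubgradientSelection.exists_norm_sub_le (hg : SubgradientSelection W g w L) {T : ℝ}
    (hT : 0 ≤ T) :
    ∃ C : ℝ, ∀ (q : ℝ) (A P B Q : ℕ → E → E), 0 < q → q ≤ 1 →
      PerturbedEuler μ g w (q ^ 4) A P → PerturbedEuler μ g w (q ^ 4) B Q →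
      ∀ (j : ℕ) (x : E), j * q ^ 4 ≤ T → ‖P j x - Q j x‖ ≤ C * q := by
  have hL := hg.L_nonneg
  have hw := hg.w_nonneg
  set K1 : ℝ := T * ((32 * L + 12) * w ^ 2) * Real.exp (8 * L * T) with hK1
  set K2 : ℝ := 2 * K1 + 8 * w ^ 2 with hK2
  set K3 : ℝ := 32 * L * w ^ 2 + 4 * L * K2 + 2 * w * (K2 + 1) + 12 * w ^ 2 with hK3
  set K4 : ℝ := T * K3 * Real.exp (8 * L * T) with hK4
  have hK1' : 0 ≤ K1 := by positivity
  have hK2' : 0 ≤ K2 := by positivity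
  have hK3' : 0 ≤ K3 := by positivity
  refine ⟨√K4 + 2 * w, fun q A P B Q hq hq1 hA hB N x hN => ?_⟩
  set h := q ^ 4 with hh
  have hh0 : 0 ≤ h := by positivity
  have hhq : h ≤ q := by
    simpa using pow_le_pow_of_le_one hq.le hq1 (show 1 ≤ 4 by norm_num)
  have hhs : h ≤ q ^ 2 := pow_le_pow_of_le_one hq.le hq1 (show 2 ≤ 4 by norm_num)
  have hh1 : h ≤ 1 := hhq.trans hq1
  have hss : h = q ^ 2 * q ^ 2 := by rw [hh]; ring
  have hm : ∀ j ≤ N, ∫ x, ‖P j x - Q j x‖ ^ 2 ∂μ ≤ K2 * h := by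
    intro j hj
    have hjT : (j : ℝ) * h ≤ T :=
      (mul_le_mul_of_nonneg_right (Nat.cast_le.2 hj) hh0).trans hN
    have h1 := hA.integral_sq_snd_le hg hB hh0 j
    have h2 := hA.integral_sq_le hg hB hh0 hh1 j
    have h3 : j * h * (h * ((32 * L + 12) * w ^ 2)) * Real.exp (8 * L * (j * h))
        ≤ T * (h * ((32 * L + 12) * w ^ 2)) * Real.exp (8 * L * T) := by gcongr
    have h4 : w ^ 2 * h * h ≤ w ^ 2 * h * 1 := mul_le_mul_of_nonneg_left hh1 (by positivity)
    have h5 : T * (h * ((32 * L + 12) * w ^ 2)) * Real.exp (8 * L * T) = K1 * h := by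
      rw [hK1]; ring
    rw [hK2]
    nlinarith
  have hd := le_of_discrete_gronwall (a := fun j => ‖A j x - B j x‖ ^ 2) (N := N)
    (α := 8 * L) (β := q ^ 2 * K3) (by positivity) (by positivity) hh0
    (by simp [hA.zero, hB.zero]) (fun j hj => by
      have h1 := hA.sq_norm_succ_sub_le hg hB hh0 j x
      have h2 := hg.inner_flowVel_sub_le (hA.measurable j) (hB.measurable j)
        (μ := μ) (hA.norm_snd_sub_le hg hB hh0 j) x
      have h3 := hm j hj.le
      have h4 := sq_norm_le_of_norm_sub_le (norm_sub_sub_sub_le (hA.near j x) (hB.near j x))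
      have hq2 : 0 < q ^ 2 := by positivity
      have hi1 : Integrable (fun y => ‖P j y - Q j y‖) μ :=
        integrable_of_norm_le ((hA.measurable j).sub (hB.measurable j)).norm
          (fun y => by simpa using hA.norm_snd_sub_le hg hB hh0 j y)
      have hi2 := hA.integrable_sq_snd hg hB hh0 j
      have h5 : 2 * ∫ y, ‖P j y - Q j y‖ ∂μ ≤ (K2 + 1) * q ^ 2 := by
        have h6 : ∫ y, 2 * ‖P j y - Q j y‖ ∂μ
            ≤ ∫ y, ((q ^ 2)⁻¹ * ‖P j y - Q j y‖ ^ 2 + q ^ 2) ∂μ := by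
          refine integral_mono (hi1.const_mul 2) ((hi2.const_mul _).add (integrable_const _))
            fun y => ?_
          have h7 := mul_nonneg (inv_nonneg.2 hq2.le)
            (sq_nonneg (‖P j y - Q j y‖ - q ^ 2))
          have h8 : (q ^ 2)⁻¹ * (‖P j y - Q j y‖ - q ^ 2) ^ 2
              = (q ^ 2)⁻¹ * ‖P j y - Q j y‖ ^ 2 + q ^ 2 - 2 * ‖P j y - Q j y‖ := by
            field_simp; ring
          linarith
        rw [integral_const_mul, integral_add (hi2.const_mul _) (integrable_const _),
          integral_const_mul, integral_const, probReal_univ, one_smul] at h6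
        have h7 := mul_le_mul_of_nonneg_left h3 (inv_nonneg.2 hq2.le)
        have h8 : (q ^ 2)⁻¹ * (K2 * h) = K2 * q ^ 2 := by rw [hss]; field_simp
        linarith
      have h6 : 2 * L * ‖P j x - Q j x‖ ^ 2 ≤ 4 * L * ‖A j x - B j x‖ ^ 2
          + 16 * L * w ^ 2 * q ^ 2 := by
        have h7 := mul_le_mul_of_nonneg_left h4 (show 0 ≤ 2 * L by positivity)
        have h8 : h * h ≤ q ^ 2 * 1 := mul_le_mul hhs hh1 hh0 hq2.le
        have h9 := mul_le_mul_of_nonneg_left h8 (show 0 ≤ 16 * L * w ^ 2 by positivity)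
        linarith
      have h7 : 2 * L * (∫ y, ‖P j y - Q j y‖ ^ 2 ∂μ) ≤ 2 * L * K2 * q ^ 2 := by
        have h8 := mul_le_mul_of_nonneg_left h3 (show 0 ≤ 2 * L by positivity)
        have h9 := mul_le_mul_of_nonneg_left hhs (show 0 ≤ 2 * L * K2 by positivity)
        linarith
      have h8 : 2 * w * (∫ y, ‖P j y - Q j y‖ ∂μ) ≤ w * (K2 + 1) * q ^ 2 := by
        have := mul_le_mul_of_nonneg_left h5 hw
        linarith
      have h9 := mul_le_mul_of_nonneg_left (h2.trans (add_le_add (add_le_add h6 h7) h8))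
        (show 0 ≤ 2 * h by positivity)
      have h10 := mul_le_mul_of_nonneg_left hhs (show 0 ≤ 12 * w ^ 2 * h by positivity)
      rw [hK3]
      linarith) N le_rfl
  have hd' : ‖A N x - B N x‖ ^ 2 ≤ K4 * q ^ 2 := by
    refine hd.trans ?_
    have : N * h * (q ^ 2 * K3) * Real.exp (8 * L * (N * h))
        ≤ T * (q ^ 2 * K3) * Real.exp (8 * L * T) := by gcongr
    refine this.trans (le_of_eq ?_)
    rw [hK4]; ring
  have hd2 : ‖A N x - B N x‖ ≤ √K4 * q := by
    have h1 := Real.le_sqrt_of_sq_le hd'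
    rwa [Real.sqrt_mul (by positivity), Real.sqrt_sq hq.le] at h1
  have h1 := norm_sub_sub_sub_le (hA.near N x) (hB.near N x)
  have h3 := norm_sub_norm_le (P N x - Q N x) (A N x - B N x)
  rw [norm_sub_rev (P N x - Q N x)] at h3
  have h4 := mul_le_mul_of_nonneg_left hhq (show 0 ≤ 2 * w by positivity)
  linarith

end Perturbed

omit [IsProbabilityMeasure μ] [FiniteDimensional ℝ E] [BorelSpace E] in
lemma euler_succ (h : ℝ) (k : ℕ) (x : E) :
    euler μ g h (k + 1) x = euler μ g h k x + h • flowVel μ g (euler μ g h k) x := rfl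

lemma SubgradientSelection.perturbedEuler_euler (hg : SubgradientSelection W g w L) {h : ℝ}
    (hh : 0 ≤ h) : PerturbedEuler μ g w h (euler μ g h) (euler μ g h) where
  measurable := hg.measurable_euler h
  zero _ := rfl
  succ _ _ := rfl
  near j x := by
    have := hg.w_nonneg
    simpa using (by positivity : 0 ≤ w * h)

/-- The scheme with step `2 * h`, sampled on the grid of step `h`. -/
lemma SubgradientSelection.perturbedEuler_two_mul (hg : SubgradientSelection W g w L) {h : ℝ}
    (hh : 0 ≤ h) : PerturbedEuler μ g w h
      (fun j x => euler μ g (2 * h) (j / 2) x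
        + (((j % 2 : ℕ) : ℝ) * h) • flowVel μ g (euler μ g (2 * h) (j / 2)) x)
      (fun j => euler μ g (2 * h) (j / 2)) where
  measurable j := hg.measurable_euler _ _
  zero x := by simp [euler]
  succ j x := by
    rcases Nat.even_or_odd' j with ⟨k, rfl | rfl⟩
    · have h1 : (2 * k + 1) / 2 = k := by omega
      have h2 : 2 * k / 2 = k := by omega
      have h3 : (2 * k + 1) % 2 = 1 := by omega
      have h4 : 2 * k % 2 = 0 := by omega
      rw [h1, h2, h3, h4]
      simp
    · have h1 : (2 * k + 1) / 2 = k := by omega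
      have h2 : (2 * k + 1 + 1) / 2 = k + 1 := by omega
      have h3 : (2 * k + 1) % 2 = 1 := by omega
      have h4 : (2 * k + 1 + 1) % 2 = 0 := by omega
      rw [h1, h2, h3, h4, euler_succ]
      simp only [Nat.cast_zero, Nat.cast_one, zero_mul, one_mul, zero_smul, add_zero, two_mul,
        add_smul]
      abel
  near j x := by
    have hw := hg.w_nonneg
    rw [add_sub_cancel_left, norm_smul, Real.norm_of_nonneg (by positivity)]
    have h1 : ((j % 2 : ℕ) : ℝ) ≤ 1 := by
      exact_mod_cast Nat.lt_succ_iff.1 (Nat.mod_lt j (by norm_num))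
    have h2 : ((j % 2 : ℕ) : ℝ) * h ≤ 1 * h := mul_le_mul_of_nonneg_right h1 hh
    have h3 := mul_le_mul h2 (hg.norm_flowVel_le (μ := μ) (euler μ g (2 * h) (j / 2)) x)
      (norm_nonneg _) (by positivity)
    linarith

/-- The dyadic Euler approximation, piecewise constant in time. -/
def eulerPath (μ : Measure E) (g : E → E) (n : ℕ) (t : ℝ) (x : E) : E :=
  euler μ g ((1 / 2) ^ n) ⌊t * 2 ^ n⌋₊ x

lemma natFloor_le_max (a : ℝ) : (⌊a⌋₊ : ℝ) ≤ max a 0 := by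
  rcases le_total 0 a with h | h
  · exact (Nat.floor_le h).trans (le_max_left _ _)
  · simp [Nat.floor_of_nonpos h]

lemma natFloor_mul_le (t : ℝ) (n : ℕ) : (⌊t * 2 ^ n⌋₊ : ℝ) * (1 / 2) ^ n ≤ max t 0 := by
  have h1 := natFloor_le_max (t * 2 ^ n)
  have h2 : max (t * 2 ^ n) 0 = max t 0 * (2 : ℝ) ^ n := by
    rw [max_mul_of_nonneg _ _ (by positivity), zero_mul]
  rw [h2] at h1
  calc (⌊t * 2 ^ n⌋₊ : ℝ) * (1 / 2) ^ n ≤ max t 0 * 2 ^ n * (1 / 2) ^ n := by gcongr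
    _ = max t 0 := by rw [mul_assoc, ← mul_pow]; norm_num

lemma SubgradientSelection.tendsto_eulerPath (hg : SubgradientSelection W g w L) :
    ∃ X : ℝ → E → E, ∀ t x, Tendsto (fun n => eulerPath μ g n t x) atTop (𝓝 (X t x)) := by
  suffices h : ∀ t x, ∃ p, Tendsto (fun n => eulerPath μ g n t x) atTop (𝓝 p) by
    choose X hX using h
    exact ⟨X, hX⟩
  intro t x
  obtain ⟨C, hC⟩ := hg.exists_norm_sub_le (μ := μ) (le_max_right t 0)
  set r : ℝ := √√(1 / 2) with hr
  have hr0 : 0 < r := by positivity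
  have hr4 : r ^ 4 = 1 / 2 := by
    have : r ^ 4 = (r ^ 2) ^ 2 := by ring
    rw [this, hr, Real.sq_sqrt (by positivity), Real.sq_sqrt (by positivity)]
  have hr1 : r < 1 := by
    by_contra! H
    have := one_le_pow₀ H (n := 4)
    linarith
  refine cauchySeq_tendsto_of_complete (cauchySeq_of_le_geometric r (C * r) hr1 fun n => ?_)
  have hq : ((1 : ℝ) / 2) ^ (n + 1) = (r ^ (n + 1)) ^ 4 := by rw [← hr4]; ring
  have hh : (0 : ℝ) ≤ (1 / 2) ^ (n + 1) := by positivity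
  have h2 : 2 * ((1 : ℝ) / 2) ^ (n + 1) = (1 / 2) ^ n := by rw [pow_succ]; ring
  have hA := hg.perturbedEuler_two_mul (μ := μ) hh
  have hB := hg.perturbedEuler_euler (μ := μ) hh
  rw [h2] at hA
  rw [hq] at hA hB
  have key := hC (r ^ (n + 1)) _ _ _ _ (by positivity) (pow_le_one₀ hr0.le hr1.le) hA hB
    ⌊t * 2 ^ (n + 1)⌋₊ x (by rw [← hq]; exact natFloor_mul_le t (n + 1))
  have hfl : ⌊t * 2 ^ (n + 1)⌋₊ / 2 = ⌊t * 2 ^ n⌋₊ := by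
    rw [← Nat.floor_div_ofNat]
    congr 1
    rw [pow_succ]; ring
  rw [dist_eq_norm, eulerPath, eulerPath, hq, ← hfl]
  refine key.trans (le_of_eq ?_)
  ring

omit [FiniteDimensional ℝ E] [BorelSpace E] in
lemma SubgradientSelection.norm_eulerPath_sub_le_of_le (hg : SubgradientSelection W g w L) (n : ℕ)
    {s t : ℝ} (hst : s ≤ t) (x : E) :
    ‖eulerPath μ g n t x - eulerPath μ g n s x‖ ≤ w * (t - s + (1 / 2) ^ n) := by
  have hw := hg.w_nonneg
  have h2 : (0 : ℝ) < 2 ^ n := by positivity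
  have hle : s * 2 ^ n ≤ t * 2 ^ n := mul_le_mul_of_nonneg_right hst h2.le
  obtain ⟨j, hj⟩ := Nat.exists_eq_add_of_le (Nat.floor_le_floor hle)
  have hjn : (j : ℝ) ≤ t * 2 ^ n - s * 2 ^ n + 1 := by
    have e : (⌊t * 2 ^ n⌋₊ : ℝ) = ⌊s * 2 ^ n⌋₊ + j := by rw [hj]; push_cast; rfl
    rcases le_total 0 (t * 2 ^ n) with h | h
    · linarith [Nat.floor_le h, Nat.lt_floor_add_one (s * 2 ^ n)]
    · rw [Nat.floor_of_nonpos h] at e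
      have : (0 : ℝ) ≤ ⌊s * 2 ^ n⌋₊ := Nat.cast_nonneg _
      push_cast at e
      linarith
  have hinv : (2 : ℝ) ^ n * (1 / 2) ^ n = 1 := by rw [← mul_pow]; norm_num
  have hjh : (j : ℝ) * (1 / 2) ^ n ≤ t - s + (1 / 2) ^ n := by
    calc (j : ℝ) * (1 / 2) ^ n ≤ (t * 2 ^ n - s * 2 ^ n + 1) * (1 / 2) ^ n := by gcongr
      _ = (t - s) * (2 ^ n * (1 / 2) ^ n) + (1 / 2) ^ n := by ring
      _ = _ := by rw [hinv, mul_one]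
  rw [eulerPath, eulerPath, hj]
  exact (hg.norm_euler_sub_le (by positivity) _ _ x).trans
    (mul_le_mul_of_nonneg_left hjh hw)

section Limit

variable {X : ℝ → E → E}

lemma tendsto_half_pow : Tendsto (fun n : ℕ => ((1 : ℝ) / 2) ^ n) atTop (𝓝 0) :=
  tendsto_pow_atTop_nhds_zero_of_lt_one (by norm_num) (by norm_num)

lemma SubgradientSelection.measurable_limit (hg : SubgradientSelection W g w L)
    (hX : ∀ t x, Tendsto (fun n => eulerPath μ g n t x) atTop (𝓝 (X t x))) (t : ℝ) :
    Measurable (X t) :=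
  measurable_of_tendsto_metrizable (fun n => hg.measurable_euler ((1 / 2) ^ n) ⌊t * 2 ^ n⌋₊)
    (tendsto_pi_nhds.2 (hX t))

omit [FiniteDimensional ℝ E] [BorelSpace E] in
lemma SubgradientSelection.norm_limit_sub_le (hg : SubgradientSelection W g w L)
    (hX : ∀ t x, Tendsto (fun n => eulerPath μ g n t x) atTop (𝓝 (X t x))) (s t : ℝ) (x : E) :
    ‖X t x - X s x‖ ≤ w * |t - s| := by
  wlog hst : s ≤ t generalizing s t
  · rw [norm_sub_rev, abs_sub_comm]
    exact this t s (le_of_not_ge hst)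
  rw [abs_of_nonneg (sub_nonneg.2 hst)]
  have h1 : Tendsto (fun n : ℕ => w * (t - s + (1 / 2) ^ n)) atTop (𝓝 (w * (t - s + 0))) :=
    (tendsto_half_pow.const_add _).const_mul _
  rw [add_zero] at h1
  exact le_of_tendsto_of_tendsto' ((hX t x).sub (hX s x)).norm h1
    fun n => hg.norm_eulerPath_sub_le_of_le n hst x

omit [IsProbabilityMeasure μ] [FiniteDimensional ℝ E] [BorelSpace E] in
lemma limit_zero (hX : ∀ t x, Tendsto (fun n => eulerPath μ g n t x) atTop (𝓝 (X t x))) (x : E) :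
    X 0 x = x := by
  refine tendsto_nhds_unique (hX 0 x) ?_
  simp [eulerPath, euler]

/-- The gap of the interaction potential of the configuration `Y` between `z` and the
particle `x`. -/
def potentialGap (μ : Measure E) (W : E → ℝ) (L : ℝ) (Y : E → E) (x z : E) : ℝ :=
  (∫ y, (W (z - Y y) - W (Y x - Y y)) ∂μ) + L / 2 * ‖z - Y x‖ ^ 2

omit [FiniteDimensional ℝ E] in
lemma SubgradientSelection.integrable_sub (hg : SubgradientSelection W g w L) {Y : E → E}
    (hY : Measurable Y) (a b : E) : Integrable (fun y => W (a - Y y) - W (b - Y y)) μ := by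
  have hc := hg.continuous_potential.measurable
  refine integrable_of_norm_le ((hc.comp (hY.const_sub a)).sub (hc.comp (hY.const_sub b)))
    (C := w * ‖a - b‖) fun y => ?_
  have := hg.lipschitz (a - Y y) (b - Y y)
  rwa [sub_sub_sub_cancel_right] at this

lemma SubgradientSelection.inner_flowVel_le_potentialGap (hg : SubgradientSelection W g w L)
    {Y : E → E} (hY : Measurable Y) (x z : E) :
    ⟪flowVel μ g Y x, Y x - z⟫ ≤ potentialGap μ W L Y x z := by
  have hi : Integrable (fun y => ⟪z - Y x, g (Y x - Y y)⟫) μ :=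
    (hg.integrable hY (Y x)).const_inner _
  have h0 : ⟪flowVel μ g Y x, Y x - z⟫ = ∫ y, ⟪z - Y x, g (Y x - Y y)⟫ ∂μ := by
    rw [← neg_sub z, inner_neg_right, real_inner_comm, hg.inner_flowVel hY, neg_neg]
  have h1 := integral_mono hi
    ((hg.integrable_sub (μ := μ) hY z (Y x)).add (integrable_const (L / 2 * ‖z - Y x‖ ^ 2)))
    fun y => by
      have := hg.subgradient (Y x - Y y) (z - Y y)
      rw [sub_sub_sub_cancel_right, real_inner_comm] at this
      simp only [Pi.add_apply]
      linarith
  simp only [Pi.add_apply] at h1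
  rw [integral_add (hg.integrable_sub hY z (Y x)) (integrable_const _)] at h1
  rw [h0, potentialGap]
  simpa using h1

lemma SubgradientSelection.potentialGap_le_inner (hg : SubgradientSelection W g w L)
    {Y : E → E} (hY : Measurable Y) (x z : E) :
    potentialGap μ W L Y x z ≤
      ⟪-∫ y, g (z - Y y) ∂μ, Y x - z⟫ + L * ‖z - Y x‖ ^ 2 := by
  have hi : Integrable (fun y => ⟪Y x - z, g (z - Y y)⟫) μ :=
    (hg.integrable hY z).const_inner _
  have hn : Integrable (fun y => -⟪Y x - z, g (z - Y y)⟫) μ := hi.neg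
  have h1 := integral_mono (hg.integrable_sub (μ := μ) hY z (Y x))
    (hn.add (integrable_const (L / 2 * ‖z - Y x‖ ^ 2)))
    fun y => by
      have := hg.subgradient (z - Y y) (Y x - Y y)
      rw [sub_sub_sub_cancel_right, real_inner_comm, norm_sub_rev] at this
      simp only [Pi.add_apply]
      linarith
  simp only [Pi.add_apply] at h1
  rw [integral_add hn (integrable_const _), integral_neg,
    integral_inner (hg.integrable hY z)] at h1
  rw [potentialGap, inner_neg_left, real_inner_comm]
  simp only [integral_const, probReal_univ, one_smul] at h1
  linarith

omit [FiniteDimensional ℝ E] in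
lemma SubgradientSelection.potentialGap_le_of_norm_sub_le (hg : SubgradientSelection W g w L)
    {Y Z : E → E} (hY : Measurable Y) (hZ : Measurable Z) {δ D R : ℝ} (hD : δ ≤ 2 * D)
    (h : ∀ y, ‖Z y - Y y‖ ≤ δ) {x z : E} (hR : ‖z - Y x‖ ≤ R) :
    potentialGap μ W L Z x z ≤ potentialGap μ W L Y x z + (3 * w + L * (R + D)) * δ := by
  have hL := hg.L_nonneg
  have hw := hg.w_nonneg
  have hδ : 0 ≤ δ := (norm_nonneg _).trans (h x)
  have h1 := integral_mono (hg.integrable_sub (μ := μ) hZ z (Z x))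
    ((hg.integrable_sub (μ := μ) hY z (Y x)).add (integrable_const (3 * w * δ)))
    fun y => by
      have h1 := (abs_le.1 (hg.lipschitz (z - Z y) (z - Y y))).2
      have h2 := (abs_le.1 (hg.lipschitz (Z x - Z y) (Y x - Y y))).1
      rw [sub_sub_sub_cancel_left, norm_sub_rev] at h1
      have h3 : ‖(Z x - Z y) - (Y x - Y y)‖ ≤ 2 * δ := by
        have : (Z x - Z y) - (Y x - Y y) = (Z x - Y x) - (Z y - Y y) := by abel
        rw [this]
        exact (norm_sub_le _ _).trans (by linarith [h x, h y])
      have h4 := mul_le_mul_of_nonneg_left h3 hw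
      have h5 := mul_le_mul_of_nonneg_left (h y) hw
      simp only [Pi.add_apply]
      linarith
  simp only [Pi.add_apply] at h1
  rw [integral_add (hg.integrable_sub hY z (Y x)) (integrable_const _)] at h1
  simp only [integral_const, probReal_univ, one_smul] at h1
  have h2 : ‖z - Z x‖ ≤ ‖z - Y x‖ + δ := by
    have := norm_sub_le (z - Y x) (Z x - Y x)
    rw [sub_sub_sub_cancel_right] at this
    linarith [h x]
  have h3 := pow_le_pow_left₀ (norm_nonneg _) h2 2
  have h4 : ‖z - Z x‖ ^ 2 ≤ ‖z - Y x‖ ^ 2 + 2 * (R + D) * δ := by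
    nlinarith [mul_le_mul_of_nonneg_right hR hδ, mul_le_mul_of_nonneg_right hD hδ]
  have h5 := mul_le_mul_of_nonneg_left h4 (show 0 ≤ L / 2 by positivity)
  rw [potentialGap, potentialGap]
  linarith

/-- Discrete evolution variational inequality. -/
lemma SubgradientSelection.sq_norm_euler_sub_le (hg : SubgradientSelection W g w L) {h R : ℝ}
    (hh : 0 ≤ h) {x z : E} (k : ℕ) (hR : ‖z - euler μ g h k x‖ ≤ R) (j : ℕ) (hj : j * h ≤ 2) :
    ‖euler μ g h (k + j) x - z‖ ^ 2 ≤ ‖euler μ g h k x - z‖ ^ 2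
      + 2 * (j * h) * (potentialGap μ W L (euler μ g h k) x z
        + (3 * w + L * (R + w)) * w * (j * h)) + w ^ 2 * h * (j * h) := by
  have hw := hg.w_nonneg
  have hL := hg.L_nonneg
  have hR0 : 0 ≤ R := (norm_nonneg _).trans hR
  induction j with
  | zero => simp
  | succ j ih =>
    have hjh : (j : ℝ) * h ≤ 2 := by
      refine le_trans ?_ hj
      push_cast
      linarith
    have h1 := ih hjh
    have h2 := hg.inner_flowVel_le_potentialGap (μ := μ)
      (hg.measurable_euler (μ := μ) h (k + j)) x z
    have h3 := hg.potentialGap_le_of_norm_sub_le (μ := μ) (hg.measurable_euler (μ := μ) h k)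
      (hg.measurable_euler (μ := μ) h (k + j)) (δ := w * (j * h)) (D := w)
      (by nlinarith) (fun y => hg.norm_euler_sub_le (μ := μ) hh k j y) hR
    have e : euler μ g h (k + (j + 1)) x - z = (euler μ g h (k + j) x - z)
        + h • flowVel μ g (euler μ g h (k + j)) x := by
      rw [← add_assoc, euler_succ]; abel
    rw [e, norm_add_sq_real, inner_smul_right, real_inner_comm, norm_smul,
      Real.norm_of_nonneg hh, mul_pow]
    have h4 := pow_le_pow_left₀ (norm_nonneg _)
      (hg.norm_flowVel_le (μ := μ) (euler μ g h (k + j)) x) 2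
    have h5 := mul_le_mul_of_nonneg_left h4 (sq_nonneg h)
    have h6 := mul_le_mul_of_nonneg_left (h2.trans h3) hh
    have h7 : 0 ≤ (3 * w + L * (R + w)) * w * h * h := by positivity
    have h8 : 0 ≤ (3 * w + L * (R + w)) * w * h * (j * h) := by positivity
    push_cast
    linarith

lemma tendsto_natFloor_mul_half_pow {t : ℝ} (ht : 0 ≤ t) :
    Tendsto (fun n : ℕ => (⌊t * 2 ^ n⌋₊ : ℝ) * (1 / 2) ^ n) atTop (𝓝 t) := by
  have h := (tendsto_nat_floor_mul_div_atTop ht).comp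
    (tendsto_pow_atTop_atTop_of_one_lt (show (1 : ℝ) < 2 by norm_num))
  refine h.congr fun n => ?_
  simp [div_eq_mul_inv]

omit [FiniteDimensional ℝ E] [BorelSpace E] in
lemma SubgradientSelection.norm_eulerPath_sub_self_le (hg : SubgradientSelection W g w L)
    (n : ℕ) (t : ℝ) (x : E) : ‖eulerPath μ g n t x - x‖ ≤ w * max t 0 := by
  have := hg.norm_euler_sub_le (μ := μ) (h := (1 / 2) ^ n) (by positivity) 0 ⌊t * 2 ^ n⌋₊ x
  rw [zero_add] at this
  exact this.trans (mul_le_mul_of_nonneg_left (natFloor_mul_le t n) hg.w_nonneg)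

lemma SubgradientSelection.tendsto_potentialGap (hg : SubgradientSelection W g w L)
    (hX : ∀ t x, Tendsto (fun n => eulerPath μ g n t x) atTop (𝓝 (X t x))) (s : ℝ) (x z : E) :
    Tendsto (fun n => potentialGap μ W L (eulerPath μ g n s) x z) atTop
      (𝓝 (potentialGap μ W L (X s) x z)) := by
  have hc := hg.continuous_potential
  refine Tendsto.add ?_ (((hX s x).const_sub z).norm.pow 2 |>.const_mul _)
  refine tendsto_integral_of_dominated_convergence
    (fun _ => w * (‖z - x‖ + w * max s 0)) (fun n => ?_) (integrable_const _)
    (fun n => .of_forall fun y => ?_) (.of_forall fun y => ?_)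
  · exact (hg.integrable_sub (hg.measurable_euler _ _) _ _).aestronglyMeasurable
  · have h1 := hg.lipschitz (z - eulerPath μ g n s y) (eulerPath μ g n s x - eulerPath μ g n s y)
    rw [sub_sub_sub_cancel_right] at h1
    refine h1.trans (mul_le_mul_of_nonneg_left ?_ hg.w_nonneg)
    have h2 := norm_sub_le (z - x) (eulerPath μ g n s x - x)
    rw [sub_sub_sub_cancel_right] at h2
    linarith [hg.norm_eulerPath_sub_self_le (μ := μ) n s x]
  · exact ((hc.tendsto _).comp ((hX s y).const_sub z)).sub
      ((hc.tendsto _).comp ((hX s x).sub (hX s y)))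

lemma SubgradientSelection.exists_sq_norm_limit_sub_le (hg : SubgradientSelection W g w L)
    (hX : ∀ t x, Tendsto (fun n => eulerPath μ g n t x) atTop (𝓝 (X t x))) {s : ℝ} (hs : 0 ≤ s)
    (x z : E) : ∃ C : ℝ, ∀ t, s ≤ t → t ≤ s + 1 → ‖X t x - z‖ ^ 2 ≤ ‖X s x - z‖ ^ 2
      + 2 * (t - s) * (potentialGap μ W L (X s) x z + C * (t - s)) := by
  set R : ℝ := ‖z - x‖ + w * max s 0 with hR
  refine ⟨(3 * w + L * (R + w)) * w, fun t hst ht => ?_⟩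
  set j : ℕ → ℕ := fun n => ⌊t * 2 ^ n⌋₊ - ⌊s * 2 ^ n⌋₊ with hj
  have hfl : ∀ n : ℕ, ⌊s * 2 ^ n⌋₊ + j n = ⌊t * 2 ^ n⌋₊ := fun n =>
    Nat.add_sub_of_le (Nat.floor_le_floor (mul_le_mul_of_nonneg_right hst (by positivity)))
  have hlim : Tendsto (fun n => (j n : ℝ) * (1 / 2) ^ n) atTop (𝓝 (t - s)) := by
    refine ((tendsto_natFloor_mul_half_pow (hs.trans hst)).sub
      (tendsto_natFloor_mul_half_pow hs)).congr fun n => ?_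
    rw [← hfl n]
    push_cast
    ring
  have hev : ∀ᶠ n in atTop, (j n : ℝ) * (1 / 2) ^ n ≤ 2 :=
    hlim.eventually_le_const (by linarith)
  have hrhs := (((hX s x).sub_const z).norm.pow 2).add
    ((hlim.const_mul 2).mul ((hg.tendsto_potentialGap hX s x z).add
      (hlim.const_mul ((3 * w + L * (R + w)) * w)))) |>.add
    ((tendsto_half_pow.const_mul (w ^ 2)).mul hlim)
  rw [mul_zero, zero_mul, add_zero] at hrhs
  refine le_of_tendsto_of_tendsto (((hX t x).sub_const z).norm.pow 2) hrhs ?_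
  filter_upwards [hev] with n hn
  have h1 := hg.sq_norm_euler_sub_le (μ := μ) (h := (1 / 2) ^ n) (R := R) (x := x) (z := z)
    (by positivity) ⌊s * 2 ^ n⌋₊ (by
      have h2 := norm_sub_le (z - x) (eulerPath μ g n s x - x)
      rw [sub_sub_sub_cancel_right] at h2
      exact h2.trans (by linarith [hg.norm_eulerPath_sub_self_le (μ := μ) n s x])) (j n) hn
  rw [hfl n] at h1
  exact h1

/-- The limit trajectories have a velocity comparable to the selected field everywhere. -/
lemma SubgradientSelection.inner_sub_le_of_hasDerivAt (hg : SubgradientSelection W g w L)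
    (hX : ∀ t x, Tendsto (fun n => eulerPath μ g n t x) atTop (𝓝 (X t x))) {s : ℝ} (hs : 0 ≤ s)
    {x p : E} (hp : HasDerivAt (fun t => X t x) p s) (z : E) :
    ⟪(-∫ y, g (z - X s y) ∂μ) - p, z - X s x⟫ ≤ L * ‖z - X s x‖ ^ 2 := by
  obtain ⟨C, hC⟩ := hg.exists_sq_norm_limit_sub_le hX hs x z
  have hd : HasDerivAt (fun t => ‖X t x - z‖ ^ 2) (2 * ⟪X s x - z, p⟫) s := by
    simpa using (hp.sub_const z).norm_sq
  have hsl := (hasDerivWithinAt_iff_tendsto_slope' (by simp)).1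
    (hd.hasDerivWithinAt (s := Set.Ioi s))
  have hr : Tendsto (fun t => 2 * (potentialGap μ W L (X s) x z + C * (t - s))) (𝓝[>] s)
      (𝓝 (2 * (potentialGap μ W L (X s) x z + C * (s - s)))) :=
    (Continuous.tendsto (by fun_prop) s).mono_left nhdsWithin_le_nhds
  have hle : 2 * ⟪X s x - z, p⟫ ≤ 2 * (potentialGap μ W L (X s) x z + C * (s - s)) := by
    refine le_of_tendsto_of_tendsto hsl hr ?_
    filter_upwards [Ioc_mem_nhdsGT (show s < s + 1 by linarith)] with t ht
    rw [slope_def_field, div_le_iff₀ (by linarith [ht.1])]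
    have := hC t ht.1.le ht.2
    linarith
  have h1 := hg.potentialGap_le_inner (hg.measurable_limit hX s) (μ := μ) x z
  have h2 : ⟪(-∫ y, g (z - X s y) ∂μ), X s x - z⟫ = -⟪(-∫ y, g (z - X s y) ∂μ), z - X s x⟫ := by
    rw [← inner_neg_right, neg_sub]
  have h3 : ⟪X s x - z, p⟫ = -⟪p, z - X s x⟫ := by
    rw [real_inner_comm, ← inner_neg_right, neg_sub]
  rw [inner_sub_left]
  rw [sub_self, mul_zero, add_zero] at hle
  linarith

end Limit
lemma integral_natFloor (f : ℕ → ℝ) (n N : ℕ) :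
    ∫ r in (0 : ℝ)..N, f ⌊r * 2 ^ n⌋₊ = ∑ k ∈ Finset.range (N * 2 ^ n), (1 / 2) ^ n * f k := by
  have h1 : ∀ k : ℕ, IntervalIntegrable (fun u : ℝ => f ⌊u⌋₊) volume (k : ℝ) ((k + 1 : ℕ) : ℝ) ∧
      ∫ u in (k : ℝ)..((k + 1 : ℕ) : ℝ), f ⌊u⌋₊ = f k := by
    intro k
    have h2 : ∀ᵐ u : ℝ, u ∈ Set.uIoc (k : ℝ) ((k + 1 : ℕ) : ℝ) → f ⌊u⌋₊ = f k := by
      filter_upwards [Measure.ae_ne volume ((k + 1 : ℕ) : ℝ)] with u hu hmem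
      rw [Set.uIoc_of_le (by push_cast; linarith)] at hmem
      have h3 : ⌊u⌋₊ = k := (Nat.floor_eq_iff ((Nat.cast_nonneg k).trans hmem.1.le)).2
        ⟨hmem.1.le, by have := lt_of_le_of_ne hmem.2 hu; push_cast at this; exact this⟩
      rw [h3]
    constructor
    · refine (intervalIntegrable_const (c := f k)).congr_ae ?_
      rw [Filter.EventuallyEq, ae_restrict_iff' measurableSet_uIoc]
      filter_upwards [h2] with u hu hmem using (hu hmem).symm
    · rw [intervalIntegral.integral_congr_ae h2, intervalIntegral.integral_const]
      simp
  rw [intervalIntegral.integral_comp_mul_right (fun u => f ⌊u⌋₊) (by positivity : (2 : ℝ) ^ n ≠ 0),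
    ← Finset.mul_sum, zero_mul]
  have h4 := intervalIntegral.sum_integral_adjacent_intervals (f := fun u : ℝ => f ⌊u⌋₊)
    (μ := volume) (a := fun k : ℕ => (k : ℝ)) (n := N * 2 ^ n) fun k _ => (h1 k).1
  simp only [Nat.cast_zero, Nat.cast_mul, Nat.cast_pow, Nat.cast_ofNat] at h4
  rw [← h4, Finset.sum_congr rfl fun k _ => (h1 k).2]
  simp

lemma exists_norm_fderiv_le {V : Type*} [NormedAddCommGroup V] [NormedSpace ℝ V] {f : V → ℝ}
    (hf : ContDiff ℝ (⊤ : ℕ∞) f) (hc : HasCompactSupport f) : ∃ B, ∀ p, ‖fderiv ℝ f p‖ ≤ B :=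
  (hc.fderiv ℝ).exists_bound_of_continuous (hf.continuous_fderiv (by simp))

lemma exists_lipschitzWith_fderiv {V : Type*} [NormedAddCommGroup V] [NormedSpace ℝ V]
    {f : V → ℝ} (hf : ContDiff ℝ (⊤ : ℕ∞) f) (hc : HasCompactSupport f) :
    ∃ K, LipschitzWith K (fderiv ℝ f) :=
  ContDiff.lipschitzWith_of_hasCompactSupport (n := (⊤ : ℕ∞)) (hc.fderiv ℝ)
    (hf.fderiv_right (by simp)) (by simp)

section WeakForm

variable {φ : ℝ × E → ℝ} {B : ℝ}

/-- The partial derivative in the first variable. -/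
def timeDeriv (φ : ℝ × E → ℝ) (p : ℝ × E) : ℝ := fderiv ℝ φ p (1, 0)

/-- The partial gradient in the second variable. -/
def spaceGrad [CompleteSpace E] (φ : ℝ × E → ℝ) (p : ℝ × E) : E :=
  (InnerProductSpace.toDual ℝ E).symm ((fderiv ℝ φ p).comp (ContinuousLinearMap.inr ℝ ℝ E))

/-- The transport operator tested against a function, symmetrized over the two particles. -/
def symKernel [CompleteSpace E] (φ : ℝ × E → ℝ) (g : E → E) (t : ℝ) (p : E × E) : ℝ :=
  timeDeriv φ (t, p.1) - 1 / 2 * ⟪spaceGrad φ (t, p.1) - spaceGrad φ (t, p.2), g (p.1 - p.2)⟫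

omit [MeasurableSpace E] [BorelSpace E] in
lemma inner_spaceGrad (p : ℝ × E) (v : E) : ⟪spaceGrad φ p, v⟫ = fderiv ℝ φ p (0, v) := by
  simp [spaceGrad]

omit [MeasurableSpace E] [BorelSpace E] in
lemma timeDeriv_add_inner (p : ℝ × E) (v : E) :
    timeDeriv φ p + ⟪v, spaceGrad φ p⟫ = fderiv ℝ φ p (1, v) := by
  rw [real_inner_comm, inner_spaceGrad, timeDeriv, ← map_add]
  simp

omit [MeasurableSpace E] [FiniteDimensional ℝ E] [BorelSpace E] in
lemma abs_timeDeriv_le (hB : ∀ p, ‖fderiv ℝ φ p‖ ≤ B) (p : ℝ × E) : |timeDeriv φ p| ≤ B := by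
  have h := (fderiv ℝ φ p).le_of_opNorm_le (hB p) (1, 0)
  simpa [Prod.norm_def, timeDeriv] using h

omit [MeasurableSpace E] [BorelSpace E] in
lemma norm_spaceGrad_le (hB : ∀ p, ‖fderiv ℝ φ p‖ ≤ B) (p : ℝ × E) : ‖spaceGrad φ p‖ ≤ B := by
  rw [spaceGrad, LinearIsometryEquiv.norm_map]
  refine (ContinuousLinearMap.opNorm_comp_le _ _).trans ?_
  calc _ ≤ ‖fderiv ℝ φ p‖ * 1 := by
        gcongr
        exact ContinuousLinearMap.norm_inr_le_one ℝ ℝ E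
    _ ≤ B := by simpa using hB p

omit [MeasurableSpace E] [FiniteDimensional ℝ E] [BorelSpace E] in
lemma continuous_timeDeriv (hφ : Continuous (fderiv ℝ φ)) : Continuous (timeDeriv φ) :=
  hφ.clm_apply continuous_const

omit [MeasurableSpace E] [BorelSpace E] in
lemma continuous_spaceGrad (hφ : Continuous (fderiv ℝ φ)) : Continuous (spaceGrad φ) :=
  (LinearIsometryEquiv.continuous _).comp (hφ.clm_comp continuous_const)

omit [BorelSpace E] in
lemma SubgradientSelection.abs_symKernel_le (hg : SubgradientSelection W g w L)
    (hB : ∀ p, ‖fderiv ℝ φ p‖ ≤ B) (t : ℝ) (p : E × E) :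
    |symKernel φ g t p| ≤ B + B * w := by
  have h1 := abs_timeDeriv_le hB (t, p.1)
  have h2 : |⟪spaceGrad φ (t, p.1) - spaceGrad φ (t, p.2), g (p.1 - p.2)⟫| ≤ 2 * B * w := by
    refine (abs_real_inner_le_norm _ _).trans ?_
    have h3 := norm_sub_le (spaceGrad φ (t, p.1)) (spaceGrad φ (t, p.2))
    have h4 := norm_spaceGrad_le hB (t, p.1)
    have h5 := norm_spaceGrad_le hB (t, p.2)
    exact mul_le_mul (by linarith) (hg.norm_le _) (norm_nonneg _)
      (by linarith [norm_nonneg (spaceGrad φ (t, p.1))])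
  rw [symKernel, abs_le]
  constructor <;> linarith [(abs_le.1 h1).1, (abs_le.1 h1).2, (abs_le.1 h2).1, (abs_le.1 h2).2]

lemma SubgradientSelection.measurable_symKernel (hg : SubgradientSelection W g w L)
    (hφ : Continuous (fderiv ℝ φ)) (t : ℝ) : Measurable (symKernel φ g t) := by
  have h1 : Measurable fun x : E => spaceGrad φ (t, x) :=
    ((continuous_spaceGrad hφ).comp (by fun_prop)).measurable
  have h2 : Measurable fun x : E => timeDeriv φ (t, x) :=
    ((continuous_timeDeriv hφ).comp (by fun_prop)).measurable
  exact (h2.comp measurable_fst).sub (((Measurable.inner ((h1.comp measurable_fst).sub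
    (h1.comp measurable_snd)) (hg.measurable.comp (measurable_fst.sub measurable_snd)))).const_mul _)

omit [BorelSpace E] in
/-- The symmetrized kernel is continuous although the interaction is not. -/
lemma SubgradientSelection.tendsto_symKernel (hg : SubgradientSelection W g w L)
    (hφ : Continuous (fderiv ℝ φ)) {s : ℕ → ℝ} {a b : ℕ → E} {t : ℝ} {x y : E}
    (hs : Tendsto s atTop (𝓝 t)) (ha : Tendsto a atTop (𝓝 x)) (hb : Tendsto b atTop (𝓝 y)) :
    Tendsto (fun n => symKernel φ g (s n) (a n, b n)) atTop (𝓝 (symKernel φ g t (x, y))) := by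
  have h1 := ((continuous_timeDeriv hφ).tendsto _).comp (hs.prodMk_nhds ha)
  have h2 := (((continuous_spaceGrad hφ).tendsto _).comp (hs.prodMk_nhds ha)).sub
    (((continuous_spaceGrad hφ).tendsto _).comp (hs.prodMk_nhds hb))
  refine h1.sub (Tendsto.const_mul _ ?_)
  by_cases hxy : x = y
  · subst hxy
    simp only [sub_self, inner_zero_left] at h2 ⊢
    refine squeeze_zero_norm (fun n => (norm_inner_le_norm _ _).trans
      (mul_le_mul_of_nonneg_left (hg.norm_le _) (norm_nonneg _))) ?_
    simpa using h2.norm.mul_const w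
  · exact h2.inner ((hg.continuousAt (x - y) (sub_ne_zero.2 hxy)).tendsto.comp (ha.sub hb))

lemma SubgradientSelection.integral_fderiv_flowVel (hg : SubgradientSelection W g w L)
    (hφ : Continuous (fderiv ℝ φ)) (hB : ∀ p, ‖fderiv ℝ φ p‖ ≤ B) {Y : E → E} (hY : Measurable Y)
    (t : ℝ) : ∫ x, fderiv ℝ φ (t, Y x) (1, flowVel μ g Y x) ∂μ =
      ∫ p : E × E, symKernel φ g t (Y p.1, Y p.2) ∂(μ.prod μ) := by
  have h1 : Measurable fun x : E => spaceGrad φ (t, Y x) :=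
    ((continuous_spaceGrad hφ).comp (by fun_prop : Continuous fun x : E => (t, x))).measurable.comp
      hY
  have h2 : Measurable fun x : E => timeDeriv φ (t, Y x) :=
    ((continuous_timeDeriv hφ).comp (by fun_prop : Continuous fun x : E => (t, x))).measurable.comp
      hY
  have hB0 : 0 ≤ B := (norm_nonneg (fderiv ℝ φ 0)).trans (hB 0)
  have i1 : Integrable (fun x => timeDeriv φ (t, Y x)) μ :=
    integrable_of_norm_le h2 fun x => abs_timeDeriv_le hB _
  have i2 : Integrable (fun x => ⟪spaceGrad φ (t, Y x), flowVel μ g Y x⟫) μ :=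
    integrable_of_norm_le (h1.inner (hg.measurable_flowVel hY)) (C := B * w) fun x =>
      (norm_inner_le_norm _ _).trans (mul_le_mul (norm_spaceGrad_le hB _) (hg.norm_flowVel_le _ _)
        (norm_nonneg _) hB0)
  have i3 : Integrable (fun p : E × E => ⟪spaceGrad φ (t, Y p.1) - spaceGrad φ (t, Y p.2),
      g (Y p.1 - Y p.2)⟫) (μ.prod μ) := by
    refine integrable_of_norm_le (C := 2 * B * w) (Measurable.inner
      ((h1.comp measurable_fst).sub (h1.comp measurable_snd)) (hg.measurable.comp
      ((hY.comp measurable_fst).sub (hY.comp measurable_snd)))) fun p =>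
      (norm_inner_le_norm _ _).trans (mul_le_mul ((norm_sub_le _ _).trans ?_) (hg.norm_le _)
      (norm_nonneg _) (by positivity))
    linarith [norm_spaceGrad_le hB (t, Y p.1), norm_spaceGrad_le hB (t, Y p.2)]
  have i4 : Integrable (fun p : E × E => timeDeriv φ (t, Y p.1)) (μ.prod μ) := i1.comp_fst μ
  simp only [← timeDeriv_add_inner, symKernel]
  simp only [real_inner_comm (spaceGrad φ _)]
  rw [integral_add i1 i2, hg.integral_inner_flowVel hY h1 fun x => norm_spaceGrad_le hB _,
    integral_sub i4 (i3.const_mul _), integral_const_mul,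
    integral_fun_fst (fun x => timeDeriv φ (t, Y x))]
  simp only [probReal_univ, one_smul]
  ring

omit [MeasurableSpace E] [FiniteDimensional ℝ E] [BorelSpace E] in
lemma abs_sub_sub_fderiv_le {K : ℝ≥0} (hd : Differentiable ℝ φ)
    (hK : LipschitzWith K (fderiv ℝ φ)) (p v : ℝ × E) :
    |φ (p + v) - φ p - fderiv ℝ φ p v| ≤ K * ‖v‖ ^ 2 := by
  have h := (convex_segment (𝕜 := ℝ) p (p + v)).norm_image_sub_le_of_norm_fderiv_le'
    (f := φ) (φ := fderiv ℝ φ p) (C := K * ‖v‖) (fun q _ => hd q) (fun q hq => by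
      refine (hK.norm_sub_le q p).trans ?_
      gcongr
      obtain ⟨c, hc, rfl⟩ := (segment_eq_image' ℝ p (p + v)).subset hq
      simp only [add_sub_cancel_left, norm_smul, Real.norm_of_nonneg hc.1]
      exact mul_le_of_le_one_left (norm_nonneg _) hc.2) (left_mem_segment ℝ _ _)
    (right_mem_segment ℝ _ _)
  simpa [pow_two, mul_assoc] using h

/-- One step of the scheme tested against a smooth function. -/
lemma SubgradientSelection.abs_integral_euler_succ_sub_le (hg : SubgradientSelection W g w L)
    (hd : Differentiable ℝ φ) {C : ℝ} (hC : ∀ p, |φ p| ≤ C) {K : ℝ≥0}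
    (hK : LipschitzWith K (fderiv ℝ φ)) (hB : ∀ p, ‖fderiv ℝ φ p‖ ≤ B) {h : ℝ} (hh : 0 ≤ h)
    (k : ℕ) :
    |(∫ x, φ ((k + 1 : ℕ) * h, euler μ g h (k + 1) x) ∂μ) - (∫ x, φ (k * h, euler μ g h k x) ∂μ)
      - h * ∫ p : E × E, symKernel φ g (k * h) (euler μ g h k p.1, euler μ g h k p.2) ∂(μ.prod μ)|
      ≤ K * (1 + w) ^ 2 * h ^ 2 := by
  have hm := hg.measurable_euler (μ := μ) h
  have i1 : ∀ j : ℕ, Integrable (fun x => φ (j * h, euler μ g h j x)) μ := fun j =>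
    integrable_of_norm_le (hd.continuous.measurable.comp (measurable_const.prodMk (hm j)))
      fun x => hC _
  have hv := hg.measurable_flowVel (μ := μ) (hm k)
  have hnv : ∀ x, ‖((1 : ℝ), flowVel μ g (euler μ g h k) x)‖ ≤ 1 + w := fun x => by
    rw [Prod.norm_def]
    have := hg.norm_flowVel_le (μ := μ) (euler μ g h k) x
    exact max_le (by simpa using hg.w_nonneg) (by linarith)
  have i2 : Integrable (fun x => fderiv ℝ φ (k * h, euler μ g h k x)
      (1, flowVel μ g (euler μ g h k) x)) μ := by
    have hcont : Continuous fun q : (ℝ × E) × E => fderiv ℝ φ q.1 (1, q.2) :=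
      (hK.continuous.comp continuous_fst).clm_apply (by fun_prop)
    exact integrable_of_norm_le (hcont.measurable.comp
      ((measurable_const.prodMk (hm k)).prodMk hv)) (C := B * (1 + w)) fun x =>
        ((fderiv ℝ φ _).le_of_opNorm_le (hB _) _).trans (mul_le_mul_of_nonneg_left (hnv x)
          ((norm_nonneg (fderiv ℝ φ 0)).trans (hB 0)))
  have i3 : Integrable (fun x => φ ((k + 1 : ℕ) * h, euler μ g h (k + 1) x)
      - φ (k * h, euler μ g h k x)) μ := (i1 (k + 1)).sub (i1 k)
  rw [← hg.integral_fderiv_flowVel hK.continuous hB (hm k), ← integral_const_mul,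
    ← integral_sub (i1 (k + 1)) (i1 k), ← integral_sub i3 (i2.const_mul h), ← Real.norm_eq_abs]
  refine (norm_integral_le_of_norm_le_const (C := K * (1 + w) ^ 2 * h ^ 2)
    (.of_forall fun x => ?_)).trans (by simp)
  have h1 := abs_sub_sub_fderiv_le hd hK (k * h, euler μ g h k x)
    (h • ((1 : ℝ), flowVel μ g (euler μ g h k) x))
  have h2 : ((k : ℝ) * h, euler μ g h k x) + h • ((1 : ℝ), flowVel μ g (euler μ g h k) x)
      = (((k + 1 : ℕ) : ℝ) * h, euler μ g h (k + 1) x) := by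
    rw [Prod.smul_mk, Prod.mk_add_mk, euler_succ]
    congr 1
    push_cast
    rw [smul_eq_mul]
    ring
  rw [h2, map_smul, smul_eq_mul, norm_smul, Real.norm_of_nonneg hh, mul_pow] at h1
  refine h1.trans ?_
  have h3 := pow_le_pow_left₀ (norm_nonneg _) (hnv x) 2
  calc _ ≤ (K : ℝ) * (h ^ 2 * (1 + w) ^ 2) := by gcongr
    _ = _ := by ring

/-- The time average of the symmetrized rate along the scheme is of the order of the step. -/
lemma SubgradientSelection.abs_integral_rate_le (hg : SubgradientSelection W g w L)
    (hd : Differentiable ℝ φ) {C : ℝ} (hC : ∀ p, |φ p| ≤ C) {K : ℝ≥0}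
    (hK : LipschitzWith K (fderiv ℝ φ)) (hB : ∀ p, ‖fderiv ℝ φ p‖ ≤ B) {N : ℕ}
    (h0 : ∀ x, φ (0, x) = 0) (hN : ∀ x, φ (N, x) = 0) (n : ℕ) :
    |∫ t in (0 : ℝ)..N, ∫ p : E × E, symKernel φ g (⌊t * 2 ^ n⌋₊ * (1 / 2) ^ n)
      (eulerPath μ g n t p.1, eulerPath μ g n t p.2) ∂(μ.prod μ)|
      ≤ N * (K * (1 + w) ^ 2) * (1 / 2) ^ n := by
  have hstep := fun k => hg.abs_integral_euler_succ_sub_le (μ := μ) hd hC hK hB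
    (h := (1 / 2) ^ n) (by positivity) k
  rw [show ∫ t in (0 : ℝ)..N, ∫ p : E × E, symKernel φ g (⌊t * 2 ^ n⌋₊ * (1 / 2) ^ n)
    (eulerPath μ g n t p.1, eulerPath μ g n t p.2) ∂(μ.prod μ) = _ from
    integral_natFloor (fun k => ∫ p : E × E, symKernel φ g (k * (1 / 2) ^ n)
      (euler μ g ((1 / 2) ^ n) k p.1, euler μ g ((1 / 2) ^ n) k p.2) ∂(μ.prod μ)) n N]
  have htel := Finset.sum_range_sub (fun k : ℕ => ∫ x, φ (k * (1 / 2) ^ n,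
    euler μ g ((1 / 2) ^ n) k x) ∂μ) (N * 2 ^ n)
  have hend : (((N * 2 ^ n : ℕ) : ℝ)) * (1 / 2) ^ n = N := by
    push_cast
    rw [mul_assoc, ← mul_pow]
    norm_num
  simp only [hend, Nat.cast_zero, zero_mul, h0, hN, integral_zero, sub_zero] at htel
  rw [← abs_neg, ← zero_sub, ← htel, ← Finset.sum_sub_distrib]
  refine (Finset.abs_sum_le_sum_abs _ _).trans ((Finset.sum_le_sum fun k _ => hstep k).trans
    (le_of_eq ?_))
  rw [Finset.sum_const, Finset.card_range, nsmul_eq_mul]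
  linear_combination (K * (1 + w) ^ 2 * (1 / 2) ^ n) * hend

/-- The limit flow solves the transport equation in the sense of distributions. -/
lemma SubgradientSelection.integral_fderiv_limit_eq_zero (hg : SubgradientSelection W g w L)
    {X : ℝ → E → E} (hX : ∀ t x, Tendsto (fun n => eulerPath μ g n t x) atTop (𝓝 (X t x)))
    (hφ : ContDiff ℝ (⊤ : ℕ∞) φ) (hc : HasCompactSupport φ) {T : ℝ}
    (hT : tsupport φ ⊆ Set.Ioo 0 T ×ˢ (Set.univ : Set E)) :
    ∫ t in Set.Icc 0 T, ∫ x, fderiv ℝ φ (t, X t x) (1, flowVel μ g (X t) x) ∂μ = 0 := by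
  have hd : Differentiable ℝ φ := hφ.differentiable (by simp)
  have hφ' : Continuous (fderiv ℝ φ) := hφ.continuous_fderiv (by simp)
  obtain ⟨C, hC⟩ := hc.exists_bound_of_continuous hd.continuous
  obtain ⟨B, hB⟩ := exists_norm_fderiv_le hφ hc
  obtain ⟨K, hK⟩ := exists_lipschitzWith_fderiv hφ hc
  obtain ⟨N, hN⟩ := exists_nat_ge T
  set R : ℕ → ℝ → ℝ := fun n t => ∫ p : E × E, symKernel φ g (⌊t * 2 ^ n⌋₊ * (1 / 2) ^ n)
    (eulerPath μ g n t p.1, eulerPath μ g n t p.2) ∂(μ.prod μ) with hR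
  set S : ℝ → ℝ := fun t => ∫ p : E × E, symKernel φ g t (X t p.1, X t p.2) ∂(μ.prod μ) with hS
  have hzero : ∀ t, t ∉ Set.Ioo 0 T → ∀ x, φ (t, x) = 0 := fun t ht x =>
    image_eq_zero_of_notMem_tsupport fun h => ht (hT h).1
  have hzero' : ∀ t, t ∉ Set.Ioo 0 T → ∀ x, fderiv ℝ φ (t, x) = 0 := fun t ht x =>
    fderiv_of_notMem_tsupport ℝ fun h => ht (hT h).1
  have hbound : ∀ t (Y : E → E), Measurable Y →
      ‖∫ p : E × E, symKernel φ g t (Y p.1, Y p.2) ∂(μ.prod μ)‖ ≤ B + B * w := fun t Y _ =>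
    (norm_integral_le_of_norm_le_const
      (.of_forall fun p => hg.abs_symKernel_le hB _ _)).trans (by simp)
  have hlim : ∀ t, 0 ≤ t → Tendsto (fun n => R n t) atTop (𝓝 (S t)) := fun t ht =>
    tendsto_integral_of_dominated_convergence (fun _ => B + B * w)
      (fun n => ((hg.measurable_symKernel hφ' _).comp
        (((hg.measurable_euler _ _).comp measurable_fst).prodMk
          ((hg.measurable_euler _ _).comp measurable_snd))).aestronglyMeasurable)
      (integrable_const _) (fun n => .of_forall fun p => hg.abs_symKernel_le hB _ _)
      (.of_forall fun p => hg.tendsto_symKernel hφ' (tendsto_natFloor_mul_half_pow ht)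
        (hX t p.1) (hX t p.2))
  have hRlim : Tendsto (fun n => ∫ t in (0 : ℝ)..N, R n t) atTop (𝓝 (∫ t in (0 : ℝ)..N, S t)) := by
    refine intervalIntegral.tendsto_integral_filter_of_dominated_convergence
      (fun _ => B + B * w) (.of_forall fun n => ?_) (.of_forall fun n => .of_forall fun t _ =>
        hbound _ _ (hg.measurable_euler _ _)) intervalIntegrable_const
      (.of_forall fun t ht => hlim t ?_)
    · exact ((measurable_from_nat (f := fun k : ℕ => ∫ p : E × E,
        symKernel φ g (k * (1 / 2) ^ n) (euler μ g ((1 / 2) ^ n) k p.1,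
          euler μ g ((1 / 2) ^ n) k p.2) ∂(μ.prod μ))).comp
        (Nat.measurable_floor.comp (measurable_id.mul_const _))).aestronglyMeasurable
    · rw [Set.uIoc_of_le N.cast_nonneg] at ht
      exact ht.1.le
  have hS0 : ∫ t in (0 : ℝ)..N, S t = 0 := by
    refine tendsto_nhds_unique hRlim (squeeze_zero_norm (fun n =>
      hg.abs_integral_rate_le hd hC hK hB
        (hzero _ fun h => lt_irrefl _ h.1) (hzero _ fun h => absurd h.2 (not_lt.2 hN)) n) ?_)
    simpa using tendsto_half_pow.const_mul (N * (K * (1 + w) ^ 2) : ℝ)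
  have heq : ∀ t, ∫ x, fderiv ℝ φ (t, X t x) (1, flowVel μ g (X t) x) ∂μ = S t := fun t =>
    hg.integral_fderiv_flowVel hφ' hB (hg.measurable_limit hX t) t
  have hout : ∀ t, t ∉ Set.Ioo 0 T → S t = 0 := fun t ht => by
    rw [← heq]
    simp [hzero' t ht]
  simp only [heq]
  rw [intervalIntegral.integral_of_le N.cast_nonneg, ← integral_Icc_eq_integral_Ioc] at hS0
  exact (setIntegral_eq_of_subset_of_forall_sdiff_eq_zero measurableSet_Icc
    (Set.Icc_subset_Icc_right hN)
    fun t ht => hout t fun h => ht.2 ⟨h.1.le, h.2.le⟩).symm.trans hS0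

end WeakForm

end EulerScheme

/-- A bounded field dominated at `x` by a linear perturbation of the constant field `p`
has `p` in its essential convex hull at `x`. -/
lemma mem_convEss_of_inner_le {d : ℕ} {b : EuclideanSpace ℝ (Fin d) → EuclideanSpace ℝ (Fin d)}
    {x p : EuclideanSpace ℝ (Fin d)} {w L : ℝ} (hL : 0 ≤ L) (hb : ∀ z, ‖b z‖ ≤ w)
    (hp : ∀ z, ⟪b z - p, z - x⟫ ≤ L * ‖z - x‖ ^ 2) : p ∈ convEss d b x := by
  simp only [convEss, Set.mem_iInter, Set.mem_Ioi, Set.mem_ofPred_eq]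
  intro r hr N hN
  by_contra hmem
  obtain ⟨f, u, hf, hu⟩ := geometric_hahn_banach_closed_point
    (convex_convexHull ℝ (b '' (ball x r \ N))).closure isClosed_closure hmem
  set q := (InnerProductSpace.toDual ℝ (EuclideanSpace ℝ (Fin d))).symm f with hq
  have hfq : ∀ v, f v = ⟪q, v⟫ := fun v => (InnerProductSpace.toDual_symm_apply).symm
  have hw : 0 ≤ w := (norm_nonneg _).trans (hb x)
  set δ := f p - u with hδ
  have hδ0 : 0 < δ := sub_pos.2 hu
  set Q := ‖q‖ + 1 with hQ
  have hQ0 : 0 < Q := by positivity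
  set A := w + ‖p‖ + 1 with hA
  have hA0 : 0 < A := by positivity
  set ε := min 1 (δ / (2 * A)) with hε
  have hε0 : 0 < ε := lt_min one_pos (by positivity)
  set s := min (r / (2 * Q)) (δ / (2 * (L + 1) * Q ^ 2)) with hs
  have hs0 : 0 < s := lt_min (by positivity) (by positivity)
  have hpos : 0 < volume (ball (x - s • q) (s * ε)) := measure_ball_pos _ _ (by positivity)
  obtain ⟨z, hz, hzN⟩ : (ball (x - s • q) (s * ε) \ N).Nonempty := by
    refine nonempty_of_measure_ne_zero (μ := volume) ?_
    rw [measure_sdiff_null hN]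
    exact hpos.ne'
  set q' := s⁻¹ • (x - z) with hq'
  have hzq : z - x = -(s • q') := by
    rw [hq', smul_inv_smul₀ hs0.ne', neg_sub]
  have hqq : ‖q - q'‖ ≤ ε := by
    have h1 : z - (x - s • q) = s • (q - q') := by
      rw [smul_sub, ← sub_add, hzq]
      abel
    rw [mem_ball, dist_eq_norm, h1, norm_smul, Real.norm_of_nonneg hs0.le] at hz
    exact (lt_of_mul_lt_mul_left hz hs0.le).le
  have hq'Q : ‖q'‖ ≤ Q := by
    have h1 := norm_sub_le q (q - q')
    rw [sub_sub_cancel] at h1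
    linarith [min_le_left 1 (δ / (2 * A))]
  have hzr : z ∈ ball x r := by
    rw [mem_ball, dist_eq_norm, hzq, norm_neg, norm_smul, Real.norm_of_nonneg hs0.le]
    calc s * ‖q'‖ ≤ r / (2 * Q) * Q := by
          gcongr
          exact min_le_left _ _
      _ = r / 2 := by field_simp
      _ < r := by linarith
  have h1 : f (b z) < u :=
    hf _ (subset_closure (subset_convexHull ℝ _ ⟨z, ⟨hzr, hzN⟩, rfl⟩))
  have h2 : ⟪b z - p, q⟫ < -δ := by
    rw [real_inner_comm, ← hfq, map_sub]
    linarith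
  have h3 := hp z
  rw [hzq, norm_neg, norm_smul, Real.norm_of_nonneg hs0.le, inner_neg_right,
    real_inner_smul_right] at h3
  have h4 : -⟪b z - p, q'⟫ ≤ L * s * ‖q'‖ ^ 2 := by
    refine le_of_mul_le_mul_left ?_ hs0
    linarith
  have h5 : L * s * ‖q'‖ ^ 2 ≤ δ / 2 := by
    calc L * s * ‖q'‖ ^ 2 ≤ (L + 1) * (δ / (2 * (L + 1) * Q ^ 2)) * Q ^ 2 := by
          gcongr
          · linarith
          · exact min_le_right _ _
      _ = δ / 2 := by field_simp
  have h6 : |⟪b z - p, q - q'⟫| ≤ δ / 2 := by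
    refine (abs_real_inner_le_norm _ _).trans ?_
    calc ‖b z - p‖ * ‖q - q'‖ ≤ A * (δ / (2 * A)) := by
          gcongr
          · linarith [norm_sub_le (b z) p, hb z]
          · exact hqq.trans (min_le_right _ _)
      _ = δ / 2 := by field_simp
  rw [inner_sub_right] at h6
  linarith [(abs_le.1 h6).1]

section Potential

variable {d : ℕ} {W : EuclideanSpace ℝ (Fin d) → ℝ} {winf lam : ℝ}

lemma hatGrad_of_ne {x : EuclideanSpace ℝ (Fin d)} (hx : x ≠ 0) :
    hatGrad d W x = gradient W x := if_neg hx

lemma hatGrad_zero : hatGrad d W 0 = 0 := if_pos rfl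

lemma PointyPotential.hatGrad_neg (hW : PointyPotential d W winf lam)
    (x : EuclideanSpace ℝ (Fin d)) : hatGrad d W (-x) = -hatGrad d W x := by
  by_cases hx : x = 0
  · simp [hx, hatGrad_zero]
  rw [hatGrad_of_ne hx, hatGrad_of_ne (neg_ne_zero.2 hx), gradient, gradient, ← map_neg]
  congr 1
  have h1 := (hW.diffAway (-x) (neg_ne_zero.2 hx)).hasFDerivAt.comp x (hasFDerivAt_id x).neg
  have h2 := h1.fderiv
  rw [show W ∘ Neg.neg = W from funext hW.even] at h2
  rw [h2]
  ext v
  simp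

lemma PointyPotential.measurable_hatGrad : Measurable (hatGrad d W) := by
  refine Measurable.ite (measurableSet_singleton 0) measurable_const ?_
  exact (LinearIsometryEquiv.continuous _).measurable.comp (measurable_fderiv ℝ W)

lemma PointyPotential.continuousAt_hatGrad (hW : PointyPotential d W winf lam)
    {x : EuclideanSpace ℝ (Fin d)} (hx : x ≠ 0) : ContinuousAt (hatGrad d W) x := by
  refine (hW.gradContinuous.continuousAt (isOpen_ne.mem_nhds hx)).congr ?_
  filter_upwards [isOpen_ne.mem_nhds hx] with y hy using (hatGrad_of_ne hy).symm

/-- The tangent inequality for the `lam`-convex potential, with `0` as a subgradient at `0`. -/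
lemma PointyPotential.subgradient (hW : PointyPotential d W winf lam)
    (a b : EuclideanSpace ℝ (Fin d)) :
    W a + ⟪hatGrad d W a, b - a⟫ - -lam / 2 * ‖b - a‖ ^ 2 ≤ W b := by
  by_cases ha : a = 0
  · have h1 := hW.lamConvex.2 (Set.mem_univ b) (Set.mem_univ (-b))
      one_half_pos.le one_half_pos.le (add_halves 1)
    simp only [smul_neg, add_neg_cancel, hW.even, norm_neg, norm_zero, smul_eq_mul] at h1
    simp only [ha, hatGrad_zero, inner_zero_left, sub_zero]
    linarith
  · rw [hatGrad_of_ne ha]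
    have hcv : ConvexOn ℝ Set.univ fun s : ℝ => W (a + s • (b - a))
        - lam / 2 * ‖a + s • (b - a)‖ ^ 2 := by
      have := hW.lamConvex.comp_affineMap (AffineMap.lineMap a b : ℝ →ᵃ[ℝ] _)
      simpa [Function.comp_def, AffineMap.lineMap_apply, add_comm] using this
    have hline : HasDerivAt (fun s : ℝ => a + s • (b - a)) (b - a) 0 := by
      simpa using ((hasDerivAt_id (0 : ℝ)).smul_const (b - a)).const_add a
    have hd1 : HasDerivAt (fun s : ℝ => W (a + s • (b - a))) ⟪gradient W a, b - a⟫ 0 := by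
      have h2 : HasFDerivAt W (InnerProductSpace.toDual ℝ _ (gradient W a))
          (a + (0 : ℝ) • (b - a)) := by
        simpa using (hW.diffAway a ha).hasGradientAt.hasFDerivAt
      have h3 := h2.comp_hasDerivAt 0 hline
      rwa [InnerProductSpace.toDual_apply_apply] at h3
    have hd2 := hd1.sub (hline.norm_sq.const_mul (lam / 2))
    have h3 := hcv.le_slope_of_hasDerivAt (Set.mem_univ 0) (Set.mem_univ 1) one_pos hd2
    simp only [slope_def_field, zero_smul, add_zero, one_smul, add_sub_cancel, sub_zero,
      div_one] at h3
    have h4 : ‖b‖ ^ 2 = ‖a‖ ^ 2 + 2 * ⟪a, b - a⟫ + ‖b - a‖ ^ 2 := by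
      rw [← norm_add_sq_real, add_sub_cancel]
    rw [h4] at h3
    linarith

lemma PointyPotential.subgradientSelection (hW : PointyPotential d W winf lam) :
    SubgradientSelection W (hatGrad d W) winf (-lam) where
  w_nonneg := hW.winf_nonneg
  L_nonneg := neg_nonneg.2 hW.lam_nonpos
  measurable := PointyPotential.measurable_hatGrad
  odd := hW.hatGrad_neg
  norm_le x := by
    by_cases hx : x = 0
    · simpa [hx, hatGrad_zero] using hW.winf_nonneg
    · rw [hatGrad_of_ne hx]
      exact hW.gradBound x hx
  continuousAt x hx := hW.continuousAt_hatGrad hx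
  lipschitz a b := by
    have h := hW.lipschitz.norm_sub_le a b
    rwa [Real.coe_toNNReal _ hW.winf_nonneg] at h
  subgradient := hW.subgradient

end Potential

section Solution

variable {d : ℕ} {W : EuclideanSpace ℝ (Fin d) → ℝ} {winf lam : ℝ}
  {μ : Measure (EuclideanSpace ℝ (Fin d))}
  {X : ℝ → EuclideanSpace ℝ (Fin d) → EuclideanSpace ℝ (Fin d)}

lemma aHat_map {Y : EuclideanSpace ℝ (Fin d) → EuclideanSpace ℝ (Fin d)} (hY : Measurable Y)
    (z : EuclideanSpace ℝ (Fin d)) :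
    aHat d W (μ.map Y) z = -∫ y, hatGrad d W (z - Y y) ∂μ := by
  rw [aHat, integral_map hY.aemeasurable]
  exact (PointyPotential.measurable_hatGrad.comp
    (measurable_id.const_sub z)).aestronglyMeasurable

lemma deriv_add_inner_gradient {φ : ℝ × EuclideanSpace ℝ (Fin d) → ℝ} (hφ : Differentiable ℝ φ)
    (t : ℝ) (x v : EuclideanSpace ℝ (Fin d)) :
    deriv (fun s => φ (s, x)) t + ⟪v, gradient (fun y => φ (t, y)) x⟫ =
      fderiv ℝ φ (t, x) (1, v) := by
  have h1 := (hφ (t, x)).hasFDerivAt.comp_hasDerivAt t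
    ((hasDerivAt_id t).prodMk (hasDerivAt_const t x))
  have h2 : HasFDerivAt (fun y => φ (t, y))
      ((fderiv ℝ φ (t, x)).comp (ContinuousLinearMap.inr ℝ ℝ _)) x :=
    (hφ (t, x)).hasFDerivAt.comp x (hasFDerivAt_prodMk_right t x)
  rw [← timeDeriv_add_inner, gradient, h2.fderiv]
  congr 1
  exact h1.deriv

variable [IsProbabilityMeasure μ]

lemma PointyPotential.sq_norm_limit_le (hW : PointyPotential d W winf lam)
    (hX : ∀ t x, Tendsto (fun n => eulerPath μ (hatGrad d W) n t x) atTop (𝓝 (X t x)))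
    {t T : ℝ} (ht : t ∈ Set.Icc 0 T) (x : EuclideanSpace ℝ (Fin d)) :
    ‖X t x‖ ^ 2 ≤ 2 * ‖x‖ ^ 2 + 2 * (winf * T) ^ 2 := by
  have h1 := hW.subgradientSelection.norm_limit_sub_le hX 0 t x
  rw [limit_zero hX, sub_zero, abs_of_nonneg ht.1] at h1
  have h2 := norm_le_norm_add_norm_sub' (X t x) x
  have h3 : winf * t ≤ winf * T := mul_le_mul_of_nonneg_left ht.2 hW.winf_nonneg
  have h4 : ‖X t x‖ ≤ ‖x‖ + winf * T := by linarith
  have h5 := pow_le_pow_left₀ (norm_nonneg _) h4 2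
  nlinarith [sq_nonneg (‖x‖ - winf * T)]

lemma PointyPotential.integrable_sq_norm_limit (hW : PointyPotential d W winf lam)
    (hX : ∀ t x, Tendsto (fun n => eulerPath μ (hatGrad d W) n t x) atTop (𝓝 (X t x)))
    (hμ : Integrable (fun x => ‖x‖ ^ 2) μ) {t T : ℝ} (ht : t ∈ Set.Icc 0 T) :
    Integrable (fun x => ‖X t x‖ ^ 2) μ :=
  ((hμ.const_mul 2).add (integrable_const (2 * (winf * T) ^ 2))).mono'
    ((hW.subgradientSelection.measurable_limit hX t).norm.pow_const 2).aestronglyMeasurable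
    (.of_forall fun x => by simpa using hW.sq_norm_limit_le hX ht x)

lemma PointyPotential.lipschitzWith_limit (hW : PointyPotential d W winf lam)
    (hX : ∀ t x, Tendsto (fun n => eulerPath μ (hatGrad d W) n t x) atTop (𝓝 (X t x)))
    (x : EuclideanSpace ℝ (Fin d)) : LipschitzWith (Real.toNNReal winf) (fun t => X t x) :=
  LipschitzWith.of_dist_le' fun s t => by
    rw [dist_eq_norm, Real.dist_eq]
    exact hW.subgradientSelection.norm_limit_sub_le hX t s x

lemma PointyPotential.filippovChar_limit (hW : PointyPotential d W winf lam)
    (hX : ∀ t x, Tendsto (fun n => eulerPath μ (hatGrad d W) n t x) atTop (𝓝 (X t x))) (T : ℝ)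
    (x : EuclideanSpace ℝ (Fin d)) :
    FilippovChar d T (fun t y => aHat d W (μ.map (X t)) y) 0 x (fun t => X t x) := by
  have hg := hW.subgradientSelection
  have hlip := hW.lipschitzWith_limit hX x
  refine ⟨hlip.continuous.continuousOn, limit_zero hX x, ?_⟩
  rw [ae_restrict_iff' measurableSet_Icc]
  filter_upwards [hlip.ae_differentiableAt] with t ht hmem
  refine ⟨_, ht.hasDerivAt, mem_convEss_of_inner_le (w := winf) hg.L_nonneg (fun z => ?_)
    fun z => ?_⟩
  · rw [aHat_map (hg.measurable_limit hX t), norm_neg]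
    exact (norm_integral_le_of_norm_le_const (.of_forall fun y => hg.norm_le _)).trans (by simp)
  · rw [aHat_map (hg.measurable_limit hX t)]
    exact hg.inner_sub_le_of_hasDerivAt hX hmem.1 ht.hasDerivAt z

lemma PointyPotential.integral_limit_eq_zero (hW : PointyPotential d W winf lam)
    (hX : ∀ t x, Tendsto (fun n => eulerPath μ (hatGrad d W) n t x) atTop (𝓝 (X t x))) {T : ℝ}
    {φ : ℝ × EuclideanSpace ℝ (Fin d) → ℝ} (hφ : ContDiff ℝ (⊤ : ℕ∞) φ) (hc : HasCompactSupport φ)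
    (hT : tsupport φ ⊆ Set.Ioo 0 T ×ˢ (Set.univ : Set (EuclideanSpace ℝ (Fin d)))) :
    ∫ t in Set.Icc (0 : ℝ) T, ∫ x, (deriv (fun s => φ (s, x)) t
      + ⟪aHat d W (μ.map (X t)) x, gradient (fun y => φ (t, y)) x⟫) ∂(μ.map (X t)) = 0 := by
  have hg := hW.subgradientSelection
  refine Eq.trans (integral_congr_ae (.of_forall fun t => ?_))
    (hg.integral_fderiv_limit_eq_zero hX hφ hc hT)
  simp only [deriv_add_inner_gradient (hφ.differentiable (by simp))]
  have hm := hg.measurable_limit hX t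
  have hφ' : Continuous (fderiv ℝ φ) := hφ.continuous_fderiv (by simp)
  have hcont : Continuous fun q : EuclideanSpace ℝ (Fin d) × EuclideanSpace ℝ (Fin d) =>
      fderiv ℝ φ (t, q.1) (1, q.2) :=
    (hφ'.comp (by fun_prop : Continuous fun q : EuclideanSpace ℝ (Fin d) × EuclideanSpace ℝ (Fin d)
      => (t, q.1))).clm_apply (by fun_prop)
  have hv : Measurable fun x => aHat d W (μ.map (X t)) x := by
    have h : StronglyMeasurable
        fun p : EuclideanSpace ℝ (Fin d) × EuclideanSpace ℝ (Fin d) => hatGrad d W (p.1 - X t p.2) :=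
      (hg.measurable.comp (measurable_fst.sub (hm.comp measurable_snd))).stronglyMeasurable
    simp only [aHat_map hm]
    exact (h.integral_prod_right (ν := μ)).measurable.neg
  have hF : Measurable fun x => fderiv ℝ φ (t, x) (1, aHat d W (μ.map (X t)) x) :=
    hcont.measurable.comp (measurable_id.prodMk hv)
  rw [integral_map hm.aemeasurable hF.aestronglyMeasurable]
  simp only [aHat_map hm, flowVel]

end Solution

/-- existence. For `W` satisfying (A0)-(A2) and `ρini ∈ 𝒫₂(ℝ^d)`, there
exists a Filippov-flow solution `(X, ρ)` of the aggregation equation on `[0,T]`; moreover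
`ρ` is a distributional solution and has uniformly bounded second moment on `[0,T]`. -/
theorem exists_filippov_solution
    {d : ℕ} (W : EuclideanSpace ℝ (Fin d) → ℝ) (winf lam : ℝ)
    (hW : PointyPotential d W winf lam)
    (ρini : Measure (EuclideanSpace ℝ (Fin d))) (hini : MemP2 ρini)
    (T : ℝ) (hT : 0 < T) :
    ∃ (X : ℝ → EuclideanSpace ℝ (Fin d) → EuclideanSpace ℝ (Fin d))
      (ρ : ℝ → Measure (EuclideanSpace ℝ (Fin d))),
      IsFilippovSolution d W T ρini X ρ ∧
      (∀ φ : ℝ × EuclideanSpace ℝ (Fin d) → ℝ, ContDiff ℝ (⊤ : ℕ∞) φ → HasCompactSupport φ →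
        tsupport φ ⊆ Set.Ioo 0 T ×ˢ (Set.univ : Set (EuclideanSpace ℝ (Fin d))) →
        (∫ t in Set.Icc (0 : ℝ) T,
          ∫ x, (deriv (fun s => φ (s, x)) t
            + ⟪aHat d W (ρ t) x, gradient (fun y => φ (t, y)) x⟫) ∂(ρ t)) = 0) ∧
      (∃ C : ℝ, ∀ t ∈ Set.Icc (0 : ℝ) T, (∫ x, ‖x‖ ^ 2 ∂(ρ t)) ≤ C) := by
  have := hini.1
  have hg := hW.subgradientSelection
  obtain ⟨X, hX⟩ := hg.tendsto_eulerPath (μ := ρini)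
  have hm := hg.measurable_limit hX
  refine ⟨X, fun t => ρini.map (X t), ⟨fun t ht => ⟨?_, ?_⟩, fun f => ?_, fun t _ => hm t,
    fun _ _ => rfl, hW.filippovChar_limit hX T⟩,
    fun φ hφ hc hsupp => hW.integral_limit_eq_zero hX hφ hc hsupp,
    ∫ x, (2 * ‖x‖ ^ 2 + 2 * (winf * T) ^ 2) ∂ρini, fun t ht => ?_⟩
  · exact Measure.isProbabilityMeasure_map (hm t).aemeasurable
  · exact (integrable_map_measure (by fun_prop) (hm t).aemeasurable).2
      (hW.integrable_sq_norm_limit hX hini.2 ht)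
  · simp only [fun t => integral_map (μ := ρini) (hm t).aemeasurable
      f.continuous.measurable.aestronglyMeasurable]
    refine (continuous_of_dominated (bound := fun _ => ‖f‖)
      (fun t => (f.continuous.measurable.comp (hm t)).aestronglyMeasurable)
      (fun t => .of_forall fun x => f.norm_coe_le_norm _) (integrable_const _)
      (.of_forall fun x => ?_)).continuousOn
    exact f.continuous.comp (hW.lipschitzWith_limit hX x).continuous
  · rw [integral_map (hm t).aemeasurable (by fun_prop)]
    exact integral_mono (hW.integrable_sq_norm_limit hX hini.2 ht)
      ((hini.2.const_mul 2).add (integrable_const _)) fun x => hW.sq_norm_limit_le hX ht x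
end
end
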